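/- arXiv:1604.00960 — 2 statements merged into one kernel-verified Lean document; each statement's English description precedes it below -/
import Mathlib

section
/- For every integer m ≥ 3 there exist a convex body C in the plane and pairwise-disjoint convex bodies Z₁, …, Zₘ contained in C with the following property: for every natural number b and every family of pairwise interior-disjoint compact convex sets Z'₁, …, Z'_{m+b} whose union equals C and which satisfy Zᵢ ⊆ Z'ᵢ for every i ≤ m, one has b ≥ 2m − 5. -/
/-- A convex body in the plane: a compact convex subset of ℝ² with nonempty interior. -/
def IsConvexBody (S : Set (ℝ × ℝ)) : Prop :=
  IsCompact S ∧ Convex ℝ S ∧ (interior S).Nonempty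

namespace Cake

/-- upper piece -/
def T (M : ℝ) : Set (ℝ × ℝ) := {p | (p.1 - 1/2)^2 + 1/64 ≤ p.2 ∧ p.2 ≤ M}
/-- lower piece -/
def B (M : ℝ) : Set (ℝ × ℝ) := {p | p.2 ≤ -(p.1 + 1/2)^2 - 1/64 ∧ -M ≤ p.2}
/-- middle cells -/
def c (X : ℝ) : Set (ℝ × ℝ) := {p | X - 7/4 ≤ p.1 ∧ p.1 ≤ X + 7/4 ∧
  p.2 ≤ (p.1 - 1/2)^2 - (p.1 - X + 1)^2 ∧ -(p.1 + 1/2)^2 + (p.1 - X - 1)^2 ≤ p.2}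
def UT (M : ℝ) : Set (ℝ × ℝ) := {p | (p.1 - 1/2)^2 + 1/64 < p.2 ∧ p.2 < M}
def UB (M : ℝ) : Set (ℝ × ℝ) := {p | p.2 < -(p.1 + 1/2)^2 - 1/64 ∧ -M < p.2}
def Uc (X : ℝ) : Set (ℝ × ℝ) := {p | X - 7/4 < p.1 ∧ p.1 < X + 7/4 ∧
  p.2 < (p.1 - 1/2)^2 - (p.1 - X + 1)^2 ∧ -(p.1 + 1/2)^2 + (p.1 - X - 1)^2 < p.2}

/-- the segment from `p` to `r` meets `U` -/
def Hit (p r : ℝ × ℝ) (U : Set (ℝ × ℝ)) : Prop :=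
  ∃ t : ℝ, 0 ≤ t ∧ t ≤ 1 ∧ (p.1 + t * (r.1 - p.1), p.2 + t * (r.2 - p.2)) ∈ U

lemma Hit.symm {p r : ℝ × ℝ} {U : Set (ℝ × ℝ)} (h : Hit p r U) : Hit r p U := by
  obtain ⟨t, h0, h1, h⟩ := h
  refine ⟨1 - t, by linarith, by linarith, ?_⟩
  convert h using 2 <;> ring

lemma Hit.mem {p r : ℝ × ℝ} {U S : Set (ℝ × ℝ)} (h : Hit p r U) (hS : Convex ℝ S)
    (hp : p ∈ S) (hr : r ∈ S) : ∃ w ∈ S, w ∈ U := by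
  obtain ⟨t, h0, h1, h⟩ := h
  refine ⟨_, ?_, h⟩
  have := hS hp hr (show (0:ℝ) ≤ 1 - t by linarith) h0 (by ring)
  convert this using 1
  ext <;> simp <;> ring

noncomputable def topP (X : ℝ) : ℝ × ℝ := (X + 3/2, (X + 1)^2 - 5)
noncomputable def botP (X : ℝ) : ℝ × ℝ := (X - 3/2, -(X - 1)^2 + 5)
noncomputable def lefP (N : ℝ) : ℝ × ℝ := (N / 2, N / 16)

lemma top_drop {N X : ℝ} {r : ℝ × ℝ} (hN : 1000 ≤ N) (h1 : N ≤ X) (h2 : X ≤ N + N/100)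
    (h3 : X - N/100 - 5 ≤ r.1) (h4 : r.1 ≤ X + N/100 + 5) (h5 : r.2 ≤ N) :
    Hit (topP X) r (Uc X) := by
  have hD : 8 * (X + 3/2) * (N/100 + 7) ≤ (X + 1)^2 - 5 - r.2 := by nlinarith
  have hDp : 2 < (X + 1)^2 - 5 - r.2 := by nlinarith
  set D := (X + 1)^2 - 5 - r.2 with hDdef
  have hD0 : 0 < D := by linarith
  set t := 2 / D with ht
  have htD : t * D = 2 := by rw [ht]; field_simp
  have ht0 : 0 < t := by positivity
  have ht1 : t ≤ 1 := by rw [ht, div_le_one hD0]; linarith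
  have hb : t * (X + 3/2) * (N/100 + 7) ≤ 1/4 := by nlinarith
  set v := t * (r.1 - (X + 3/2)) with hv
  have hv1 : v * (X + 3/2) ≤ 1/4 := by
    have : t * (X + 3/2) * (r.1 - (X + 3/2)) ≤ t * (X + 3/2) * (N/100 + 7) :=
      mul_le_mul_of_nonneg_left (by linarith) (by nlinarith)
    rw [hv]; nlinarith
  have hv2 : -(1/4) ≤ v * (X + 3/2) := by
    have : t * (X + 3/2) * (-(N/100 + 7)) ≤ t * (X + 3/2) * (r.1 - (X + 3/2)) :=
      mul_le_mul_of_nonneg_left (by linarith) (by nlinarith)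
    rw [hv]; nlinarith
  have hv3 : v ≤ 1/1000 := by nlinarith
  have hv4 : -(1/1000) ≤ v := by nlinarith
  have e2 : t * (r.2 - ((X + 1)^2 - 5)) = -2 := by linarith
  refine ⟨t, ht0.le, ht1, ?_⟩
  simp only [topP, Uc, Set.mem_ofPred_eq, ← hv, e2]
  refine ⟨by linarith, by linarith, by nlinarith, by nlinarith⟩

lemma bot_drop {N X : ℝ} {r : ℝ × ℝ} (hN : 1000 ≤ N) (h1 : N ≤ X) (h2 : X ≤ N + N/100)
    (h3 : X - N/100 - 5 ≤ r.1) (h4 : r.1 ≤ X + N/100 + 5) (h5 : 0 ≤ r.2) :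
    Hit (botP X) r (Uc X) := by
  have hD : 8 * (X + 3/2) * (N/100 + 7) ≤ (X - 1)^2 - 5 + r.2 := by nlinarith
  have hDp : 2 < (X - 1)^2 - 5 + r.2 := by nlinarith
  set D := (X - 1)^2 - 5 + r.2 with hDdef
  have hD0 : 0 < D := by linarith
  set t := 2 / D with ht
  have htD : t * D = 2 := by rw [ht]; field_simp
  have ht0 : 0 < t := by positivity
  have ht1 : t ≤ 1 := by rw [ht, div_le_one hD0]; linarith
  have hb : t * (X + 3/2) * (N/100 + 7) ≤ 1/4 := by nlinarith
  set v := t * (r.1 - (X - 3/2)) with hv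
  have hv1 : v * (X + 3/2) ≤ 1/4 := by
    have : t * (X + 3/2) * (r.1 - (X - 3/2)) ≤ t * (X + 3/2) * (N/100 + 7) :=
      mul_le_mul_of_nonneg_left (by linarith) (by nlinarith)
    rw [hv]; nlinarith
  have hv2 : -(1/4) ≤ v * (X + 3/2) := by
    have : t * (X + 3/2) * (-(N/100 + 7)) ≤ t * (X + 3/2) * (r.1 - (X - 3/2)) :=
      mul_le_mul_of_nonneg_left (by linarith) (by nlinarith)
    rw [hv]; nlinarith
  have hv3 : v ≤ 1/1000 := by nlinarith
  have hv4 : -(1/1000) ≤ v := by nlinarith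
  have e2 : t * (r.2 - (-(X - 1)^2 + 5)) = 2 := by linarith
  refine ⟨t, ht0.le, ht1, ?_⟩
  simp only [botP, Uc, Set.mem_ofPred_eq, ← hv, e2]
  refine ⟨by linarith, by linarith, by nlinarith, by nlinarith⟩

lemma top_T {N X : ℝ} (hN : 1000 ≤ N) (h1 : N ≤ X) (h2 : X ≤ N + N/100) :
    ∃ z ∈ T ((10*N)^2), Hit (topP X) z (Uc (X+4)) := by
  refine ⟨(X + 7/2, (X+3)^2 + 1/64), ?_, 1/2, by norm_num, by norm_num, ?_⟩
  · simp only [T, Set.mem_ofPred_eq]; constructor <;> nlinarith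
  · simp only [topP, Uc, Set.mem_ofPred_eq]; refine ⟨?_, ?_, ?_, ?_⟩ <;> nlinarith

lemma bot_B {N X : ℝ} (hN : 1000 ≤ N) (h1 : N ≤ X) (h2 : X ≤ N + N/100) :
    ∃ z ∈ B ((10*N)^2), Hit (botP X) z (Uc (X-4)) := by
  refine ⟨(X - 7/2, -(X-3)^2 - 1/64), ?_, 1/2, by norm_num, by norm_num, ?_⟩
  · simp only [B, Set.mem_ofPred_eq]; constructor <;> nlinarith
  · simp only [botP, Uc, Set.mem_ofPred_eq]; refine ⟨?_, ?_, ?_, ?_⟩ <;> nlinarith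

lemma top_c {N X : ℝ} (hN : 1000 ≤ N) (h1 : N ≤ X) (h2 : X ≤ N + N/100) :
    ∃ z ∈ c X, Hit (topP X) z (UT ((10*N)^2)) := by
  refine ⟨(X - 7/4, (X-9/4)^2 - 9/16), ?_, 3/4, by norm_num, by norm_num, ?_⟩
  · simp only [c, Set.mem_ofPred_eq]; refine ⟨?_, ?_, ?_, ?_⟩ <;> nlinarith
  · simp only [topP, UT, Set.mem_ofPred_eq]; refine ⟨?_, ?_⟩ <;> nlinarith

lemma bot_c {N X : ℝ} (hN : 1000 ≤ N) (h1 : N ≤ X) (h2 : X ≤ N + N/100) :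
    ∃ z ∈ c X, Hit (botP X) z (UB ((10*N)^2)) := by
  refine ⟨(X + 7/4, -(X+9/4)^2 + 9/16), ?_, 3/4, by norm_num, by norm_num, ?_⟩
  · simp only [c, Set.mem_ofPred_eq]; refine ⟨?_, ?_, ?_, ?_⟩ <;> nlinarith
  · simp only [botP, UB, Set.mem_ofPred_eq]; refine ⟨?_, ?_⟩ <;> nlinarith

lemma top_top_near {N X : ℝ} (hN : 1000 ≤ N) (h1 : N ≤ X) :
    Hit (topP X) (topP (X+4)) (Uc (X+4)) := by
  refine ⟨1/4, by norm_num, by norm_num, ?_⟩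
  simp only [topP, Uc, Set.mem_ofPred_eq]; refine ⟨?_, ?_, ?_, ?_⟩ <;> nlinarith

lemma bot_bot_near {N X : ℝ} (hN : 1000 ≤ N) (h1 : N ≤ X) :
    Hit (botP (X+4)) (botP X) (Uc X) := by
  refine ⟨1/4, by norm_num, by norm_num, ?_⟩
  simp only [botP, Uc, Set.mem_ofPred_eq]; refine ⟨?_, ?_, ?_, ?_⟩ <;> nlinarith

lemma top_top_far {N X Y : ℝ} (hN : 1000 ≤ N) (h1 : N ≤ X) (h : X + 8 ≤ Y) (h2 : Y ≤ N + N/100) :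
    Hit (topP X) (topP Y) (UT ((10*N)^2)) := by
  refine ⟨1/2, by norm_num, by norm_num, ?_⟩
  simp only [topP, UT, Set.mem_ofPred_eq]; refine ⟨?_, ?_⟩ <;> nlinarith

lemma bot_bot_far {N X Y : ℝ} (hN : 1000 ≤ N) (h1 : N ≤ X) (h : X + 8 ≤ Y) (h2 : Y ≤ N + N/100) :
    Hit (botP X) (botP Y) (UB ((10*N)^2)) := by
  refine ⟨1/2, by norm_num, by norm_num, ?_⟩
  simp only [botP, UB, Set.mem_ofPred_eq]; refine ⟨?_, ?_⟩ <;> nlinarith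

lemma lef_B {N : ℝ} (hN : 1000 ≤ N) :
    ∃ z ∈ B ((10*N)^2), Hit (lefP N) z (UT ((10*N)^2)) := by
  have e : (N/2 - 1/2) / (N/2+1/2) * (N/2+1/2) = N/2 - 1/2 := by field_simp
  set t := (N/2 - 1/2) / (N/2+1/2) with ht
  have t0 : 0 ≤ t := by rw [ht]; apply div_nonneg <;> linarith
  have t1 : t ≤ 1 := by rw [ht, div_le_one] <;> linarith
  refine ⟨(-1/2, -1/64), ?_, t, t0, t1, ?_⟩
  · simp only [B, Set.mem_ofPred_eq]; constructor <;> nlinarith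
  · have : N/2 + t * (-1/2 - N/2) = 1/2 := by linarith
    simp only [lefP, UT, Set.mem_ofPred_eq, this]; refine ⟨?_, ?_⟩ <;> nlinarith

lemma lef_T {N : ℝ} (hN : 1000 ≤ N) :
    ∃ z ∈ T ((10*N)^2), Hit (lefP N) z (Uc N) := by
  have e : 1 / (N-2) * (N-2) = 1 := by field_simp [show N - 2 ≠ 0 by linarith]
  set t := 1 / (N-2) with ht
  have t0 : 0 ≤ t := by rw [ht]; apply div_nonneg <;> linarith
  have t1 : t ≤ 1 := by rw [ht, div_le_one] <;> linarith
  have t2 : t ≤ 1/500 := by nlinarith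
  refine Exists.intro (N-1, (N-3/2)^2+1/64) ⟨?_, Hit.symm ⟨t, t0, t1, ?_⟩⟩
  · simp only [T, Set.mem_ofPred_eq]; constructor <;> nlinarith
  · have : N-1 + t * (N/2-(N-1)) = N - 3/2 := by linarith
    have e2 : (N-3/2)^2+1/64 + t * (N/16-((N-3/2)^2+1/64)) = (N-3/2)^2+1/64 + (1/16 + t*(1/8)
      - (N-2) - 1 - t * (1/4) - t /64) := by
      linear_combination (1/16 - (N-2) - 1) * e
    simp only [lefP, Uc, Set.mem_ofPred_eq, this, e2]; refine ⟨?_, ?_, ?_, ?_⟩ <;> nlinarith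

lemma lef_c {N : ℝ} (hN : 1000 ≤ N) :
    ∃ z ∈ c N, Hit (lefP N) z (UB ((10*N)^2)) := by
  have e : 3 / (2*N+7) * (2*N+7) = 3 := by field_simp
  set t := 3 / (2*N+7) with ht
  have t0 : 0 ≤ t := by rw [ht]; apply div_nonneg <;> linarith
  have t1 : t ≤ 1 := by rw [ht, div_le_one] <;> linarith
  have t2 : t ≤ 3/2000 := by nlinarith
  refine Exists.intro (N+7/4, -(N+9/4)^2+9/16) ⟨?_, Hit.symm ⟨t, t0, t1, ?_⟩⟩
  · simp only [c, Set.mem_ofPred_eq]; refine ⟨?_, ?_, ?_, ?_⟩ <;> nlinarith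
  · have : N+7/4 + t * (N/2-(N+7/4)) = N + 1 := by linarith
    simp only [lefP, UB, Set.mem_ofPred_eq, this]; refine ⟨?_, ?_⟩ <;> nlinarith

lemma lef_cc {N X : ℝ} (hN : 1000 ≤ N) (hX : N ≤ X) : Hit (lefP N) (X, 0) (Uc N) := by
  have hp : 0 < X - N/2 := by linarith
  have e : (N/2) / (X-N/2) * (X-N/2) = N/2 := div_mul_cancel₀ _ hp.ne'
  set t := (N/2) / (X-N/2) with ht
  have t0 : 0 ≤ t := by rw [ht]; apply div_nonneg <;> linarith
  have t1 : t ≤ 1 := by rw [ht, div_le_one] <;> linarith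
  refine ⟨t, t0, t1, ?_⟩
  have : N/2 + t * (X - N/2) = N := by linarith
  simp only [lefP, Uc, Set.mem_ofPred_eq, this]; refine ⟨?_, ?_, ?_, ?_⟩ <;> nlinarith

lemma top_lef_near {N : ℝ} (hN : 1000 ≤ N) : Hit (topP N) (lefP N) (Uc N) := by
  have e : 3 / (N/2+3/2) * (N/2+3/2) = 3 := by field_simp
  set t := 3 / (N/2+3/2) with ht
  have t0 : 0 ≤ t := by rw [ht]; apply div_nonneg <;> linarith
  have t1 : t ≤ 1 := by rw [ht, div_le_one] <;> linarith
  have t2 : t ≤ 6/1000 := by nlinarith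
  refine ⟨t, t0, t1, ?_⟩
  have : N + 3/2 + t * (N/2-(N+3/2)) = N - 3/2 := by linarith
  simp only [topP, lefP, Uc, Set.mem_ofPred_eq, this]; refine ⟨?_, ?_, ?_, ?_⟩ <;> nlinarith

lemma bot_lef_near {N : ℝ} (hN : 1000 ≤ N) : Hit (botP (N+4)) (lefP N) (Uc N) := by
  have e : 1 / (N/2+5/2) * (N/2+5/2) = 1 := by field_simp
  set t := 1 / (N/2+5/2) with ht
  have t0 : 0 ≤ t := by rw [ht]; apply div_nonneg <;> linarith
  have t1 : t ≤ 1 := by rw [ht, div_le_one] <;> linarith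
  have t2 : t ≤ 2/1000 := by nlinarith
  refine ⟨t, t0, t1, ?_⟩
  have : N + 4 - 3/2 + t * (N/2-(N+4-3/2)) = N + 3/2 := by linarith
  simp only [botP, lefP, Uc, Set.mem_ofPred_eq, this]; refine ⟨?_, ?_, ?_, ?_⟩ <;> nlinarith

lemma top_lef_far {N X : ℝ} (hN : 1000 ≤ N) (h1 : N + 4 ≤ X) (h2 : X ≤ N + N/100) :
    Hit (topP X) (lefP N) (UT ((10*N)^2)) := by
  have hp : 0 < X + 3/2 - N/2 := by linarith
  have e : 1 / (X+3/2-N/2) * (X+3/2-N/2) = 1 := div_mul_cancel₀ _ hp.ne'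
  set t := 1 / (X+3/2-N/2) with ht
  have t0 : 0 < t := by rw [ht]; apply div_pos <;> linarith
  have t1 : t ≤ 1 := by rw [ht, div_le_one] <;> linarith
  refine ⟨t, t0.le, t1, ?_⟩
  have : X + 3/2 + t * (N/2-(X+3/2)) = X + 1/2 := by linarith
  simp only [topP, lefP, UT, Set.mem_ofPred_eq, this]
  have key : 0 < t * (((X+1)^2 - 5 - X^2 - 1/64) * (X+3/2-N/2) + N/16 - ((X+1)^2-5)) := by
    apply mul_pos t0; nlinarith
  refine ⟨?_, ?_⟩
  · nlinarith
  · have : 0 ≤ t * ((X+1)^2-5 - N/16) := mul_nonneg t0.le (by nlinarith)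
    nlinarith

lemma bot_lef_far {N X : ℝ} (hN : 1000 ≤ N) (h1 : N + 8 ≤ X) (h2 : X ≤ N + N/100) :
    Hit (botP X) (lefP N) (UB ((10*N)^2)) := by
  have hp : 0 < X - 3/2 - N/2 := by linarith
  have e : 1 / (X-3/2-N/2) * (X-3/2-N/2) = 1 := div_mul_cancel₀ _ hp.ne'
  set t := 1 / (X-3/2-N/2) with ht
  have t0 : 0 < t := by rw [ht]; apply div_pos <;> linarith
  have t1 : t ≤ 1 := by rw [ht, div_le_one] <;> linarith
  refine ⟨t, t0.le, t1, ?_⟩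
  have : X - 3/2 + t * (N/2-(X-3/2)) = X - 5/2 := by linarith
  simp only [botP, lefP, UB, Set.mem_ofPred_eq, this]
  have key : 0 < t * (((X-1)^2 - 5 - (X-2)^2 - 1/64) * (X-3/2-N/2) - N/16 - ((X-1)^2-5)) := by
    apply mul_pos t0; nlinarith
  refine ⟨?_, ?_⟩
  · nlinarith
  · have : 0 ≤ t * ((X-1)^2-5 + N/16) := mul_nonneg t0.le (by nlinarith)
    nlinarith


lemma closed_and {p q : ℝ × ℝ → Prop} (hp : IsClosed {x | p x}) (hq : IsClosed {x | q x}) :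
    IsClosed {x | p x ∧ q x} := hp.inter hq

lemma UT_sub (M : ℝ) : UT M ⊆ interior (T M) := by
  apply interior_maximal
  · rintro p ⟨h1, h2⟩; exact ⟨h1.le, h2.le⟩
  · refine IsOpen.and (isOpen_lt ?_ ?_) (isOpen_lt ?_ ?_) <;> fun_prop

lemma UB_sub (M : ℝ) : UB M ⊆ interior (B M) := by
  apply interior_maximal
  · rintro p ⟨h1, h2⟩; exact ⟨h1.le, h2.le⟩
  · refine IsOpen.and (isOpen_lt ?_ ?_) (isOpen_lt ?_ ?_) <;> fun_prop

lemma Uc_sub (X : ℝ) : Uc X ⊆ interior (c X) := by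
  apply interior_maximal
  · rintro p ⟨h1, h2, h3, h4⟩; exact ⟨h1.le, h2.le, h3.le, h4.le⟩
  · refine IsOpen.and (isOpen_lt ?_ ?_) (IsOpen.and (isOpen_lt ?_ ?_)
      (IsOpen.and (isOpen_lt ?_ ?_) (isOpen_lt ?_ ?_))) <;> fun_prop

lemma T_closed (M : ℝ) : IsClosed (T M) := by
  refine closed_and (isClosed_le ?_ ?_) (isClosed_le ?_ ?_) <;> fun_prop

lemma B_closed (M : ℝ) : IsClosed (B M) := by
  refine closed_and (isClosed_le ?_ ?_) (isClosed_le ?_ ?_) <;> fun_prop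

lemma c_closed (X : ℝ) : IsClosed (c X) := by
  refine closed_and (isClosed_le ?_ ?_) (closed_and (isClosed_le ?_ ?_)
      (closed_and (isClosed_le ?_ ?_) (isClosed_le ?_ ?_))) <;> fun_prop

lemma T_convex (M : ℝ) : Convex ℝ (T M) := by
  rintro ⟨x1, y1⟩ ⟨h1, h2⟩ ⟨x2, y2⟩ ⟨h3, h4⟩ a b ha hb hab
  obtain rfl : b = 1 - a := by linarith
  simp only [T, Set.mem_ofPred_eq, Prod.smul_mk, Prod.mk_add_mk, smul_eq_mul] at *
  constructor
  · nlinarith [mul_le_mul_of_nonneg_left h1 ha, mul_le_mul_of_nonneg_left h3 hb,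
      mul_nonneg (mul_nonneg ha hb) (sq_nonneg (x1 - x2))]
  · nlinarith [mul_le_mul_of_nonneg_left h2 ha, mul_le_mul_of_nonneg_left h4 hb]

lemma B_convex (M : ℝ) : Convex ℝ (B M) := by
  rintro ⟨x1, y1⟩ ⟨h1, h2⟩ ⟨x2, y2⟩ ⟨h3, h4⟩ a b ha hb hab
  obtain rfl : b = 1 - a := by linarith
  simp only [B, Set.mem_ofPred_eq, Prod.smul_mk, Prod.mk_add_mk, smul_eq_mul] at *
  constructor
  · nlinarith [mul_le_mul_of_nonneg_left h1 ha, mul_le_mul_of_nonneg_left h3 hb,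
      mul_nonneg (mul_nonneg ha hb) (sq_nonneg (x1 - x2))]
  · nlinarith [mul_le_mul_of_nonneg_left h2 ha, mul_le_mul_of_nonneg_left h4 hb]

lemma c_convex (X : ℝ) : Convex ℝ (c X) := by
  rintro ⟨x1, y1⟩ ⟨h1, h2, h3, h4⟩ ⟨x2, y2⟩ ⟨h5, h6, h7, h8⟩ a b ha hb hab
  obtain rfl : b = 1 - a := by linarith
  simp only [c, Set.mem_ofPred_eq, Prod.smul_mk, Prod.mk_add_mk, smul_eq_mul] at *
  refine ⟨?_, ?_, ?_, ?_⟩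
  · nlinarith [mul_le_mul_of_nonneg_left h1 ha, mul_le_mul_of_nonneg_left h5 hb]
  · nlinarith [mul_le_mul_of_nonneg_left h2 ha, mul_le_mul_of_nonneg_left h6 hb]
  · nlinarith [mul_le_mul_of_nonneg_left h3 ha, mul_le_mul_of_nonneg_left h7 hb]
  · nlinarith [mul_le_mul_of_nonneg_left h4 ha, mul_le_mul_of_nonneg_left h8 hb]

/-- the cake -/
def cake (M : ℝ) : Set (ℝ × ℝ) := Set.Icc (-M, -M) (M, M)

lemma mem_cake {M : ℝ} {p : ℝ × ℝ} :
    p ∈ cake M ↔ (-M ≤ p.1 ∧ p.1 ≤ M) ∧ (-M ≤ p.2 ∧ p.2 ≤ M) := by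
  simp only [cake, Set.mem_Icc, Prod.le_def]; tauto

lemma cake_body {M : ℝ} (hM : 0 < M) : IsConvexBody (cake M) := by
  refine ⟨isCompact_Icc, convex_Icc _ _, ?_⟩
  rw [cake, ← Set.Icc_prod_Icc, interior_prod_eq, interior_Icc]
  exact ⟨(0, 0), by simp [hM]⟩

lemma T_cake {M : ℝ} (hM : 4 ≤ M) : T M ⊆ cake M := by
  rintro p ⟨h1, h2⟩
  rw [mem_cake]
  refine ⟨⟨?_, ?_⟩, ?_, ?_⟩ <;> nlinarith

lemma B_cake {M : ℝ} (hM : 4 ≤ M) : B M ⊆ cake M := by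
  rintro p ⟨h1, h2⟩
  rw [mem_cake]
  refine ⟨⟨?_, ?_⟩, ?_, ?_⟩ <;> nlinarith

lemma c_cake {N X : ℝ} (hN : 1000 ≤ N) (h1 : N ≤ X) (h2 : X ≤ N + N/100) :
    c X ⊆ cake ((10*N)^2) := by
  rintro p ⟨h3, h4, h5, h6⟩
  rw [mem_cake]
  refine ⟨⟨?_, ?_⟩, ?_, ?_⟩ <;> nlinarith

lemma T_body {M : ℝ} (hM : 4 ≤ M) : IsConvexBody (T M) :=
  ⟨isCompact_Icc.of_isClosed_subset (T_closed M) (T_cake hM), T_convex M,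
    ⟨_, UT_sub M (show ((1/2 : ℝ), (1 : ℝ)) ∈ UT M by
      simp only [UT, Set.mem_ofPred_eq]; constructor <;> linarith)⟩⟩

lemma B_body {M : ℝ} (hM : 4 ≤ M) : IsConvexBody (B M) :=
  ⟨isCompact_Icc.of_isClosed_subset (B_closed M) (B_cake hM), B_convex M,
    ⟨_, UB_sub M (show ((-1/2 : ℝ), (-1 : ℝ)) ∈ UB M by
      simp only [UB, Set.mem_ofPred_eq]; constructor <;> linarith)⟩⟩

lemma center_mem {X : ℝ} (h : 1000 ≤ X) : (X, (0:ℝ)) ∈ Uc X := by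
  simp only [Uc, Set.mem_ofPred_eq]; refine ⟨?_, ?_, ?_, ?_⟩ <;> nlinarith

lemma c_body {N X : ℝ} (hN : 1000 ≤ N) (h1 : N ≤ X) (h2 : X ≤ N + N/100) : IsConvexBody (c X) :=
  ⟨isCompact_Icc.of_isClosed_subset (c_closed X) (c_cake hN h1 h2), c_convex X,
    ⟨_, Uc_sub X (center_mem (by linarith))⟩⟩

lemma disj_TB (M : ℝ) : Disjoint (T M) (B M) := by
  rw [Set.disjoint_left]
  rintro p ⟨h1, h2⟩ ⟨h3, h4⟩
  nlinarith [sq_nonneg (p.1 - 1/2), sq_nonneg (p.1 + 1/2)]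

lemma disj_Tc (M X : ℝ) : Disjoint (T M) (c X) := by
  rw [Set.disjoint_left]
  rintro p ⟨h1, h2⟩ ⟨h3, h4, h5, h6⟩
  nlinarith [sq_nonneg (p.1 - X + 1)]

lemma disj_Bc (M X : ℝ) : Disjoint (B M) (c X) := by
  rw [Set.disjoint_left]
  rintro p ⟨h1, h2⟩ ⟨h3, h4, h5, h6⟩
  nlinarith [sq_nonneg (p.1 - X - 1)]

lemma disj_cc {X Y : ℝ} (h : X + 4 ≤ Y) : Disjoint (c X) (c Y) := by
  rw [Set.disjoint_left]
  rintro p ⟨h1, h2, -⟩ ⟨h3, h4, -⟩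
  linarith

/-- the pieces -/
def Zf (N : ℝ) : ℕ → Set (ℝ × ℝ)
  | 0 => T ((10*N)^2)
  | 1 => B ((10*N)^2)
  | k + 2 => c (N + 4 * k)

/-- open subsets of the pieces -/
def Uf (N : ℝ) : ℕ → Set (ℝ × ℝ)
  | 0 => UT ((10*N)^2)
  | 1 => UB ((10*N)^2)
  | k + 2 => Uc (N + 4 * k)

lemma Uf_sub (N : ℝ) (k : ℕ) : Uf N k ⊆ interior (Zf N k) := by
  match k with
  | 0 => exact UT_sub _
  | 1 => exact UB_sub _
  | k + 2 => exact Uc_sub _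

lemma Zf_disj (N : ℝ) {i j : ℕ} (h : i < j) : Disjoint (Zf N i) (Zf N j) := by
  match i, j, h with
  | 0, 1, _ => exact disj_TB _
  | 0, k + 2, _ => exact disj_Tc _ _
  | 1, k + 2, _ => exact disj_Bc _ _
  | i + 2, j + 2, h =>
    refine disj_cc ?_
    have : ((i + 1 : ℕ) : ℝ) ≤ j := by exact_mod_cast (by omega : i + 1 ≤ j)
    push_cast at this
    linarith

lemma core {m b : ℕ} {C : Set (ℝ × ℝ)} {Z U : Fin m → Set (ℝ × ℝ)} {H : Type} [Fintype H]
    (pt : H → ℝ × ℝ) (hC : IsConvexBody C) (hU : ∀ i, U i ⊆ interior (Z i))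
    (hpt : ∀ h, pt h ∈ C)
    (hA : ∀ h i, ∃ j, j ≠ i ∧ ∃ z ∈ Z i, Hit (pt h) z (U j))
    (hB : ∀ h h', h ≠ h' → ∃ j, Hit (pt h) (pt h') (U j))
    (Z' : Fin (m + b) → Set (ℝ × ℝ))
    (h1 : ∀ i, IsCompact (Z' i) ∧ Convex ℝ (Z' i))
    (h2 : ∀ i j, i ≠ j → Disjoint (interior (Z' i)) (interior (Z' j)))
    (h3 : (⋃ i, Z' i) = C)
    (h4 : ∀ i : Fin m, Z i ⊆ Z' (Fin.castAdd b i)) : Fintype.card H ≤ b := by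
  -- a fat set containing a point of the interior of another one is impossible
  have key : ∀ (k : Fin (m + b)) (j : Fin m), k ≠ Fin.castAdd b j → (interior (Z' k)).Nonempty →
      ∀ w ∈ Z' k, w ∉ U j := by
    intro k j hkj hne w hw hwU
    have hw' : w ∈ closure (interior (Z' k)) := by
      rw [(h1 k).2.closure_interior_eq_closure_of_nonempty_interior hne]
      exact subset_closure hw
    have hwj : w ∈ interior (Z' (Fin.castAdd b j)) := interior_mono (h4 j) (hU j hwU)
    obtain ⟨x, hx1, hx2⟩ := mem_closure_iff.1 hw' _ isOpen_interior hwj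
    exact Set.disjoint_left.1 (h2 _ _ hkj) hx2 hx1
  -- each point of `C` is in a fat set
  have fat : ∀ p ∈ C, ∃ k, (interior (Z' k)).Nonempty ∧ p ∈ Z' k := by
    set F : Set (ℝ × ℝ) := ⋃ k ∈ {k | (interior (Z' k)).Nonempty}, Z' k with hF
    have hFc : IsClosed F :=
      (Set.toFinite _).isClosed_biUnion fun k _ => (h1 k).1.isClosed
    set G : Set (ℝ × ℝ) := ⋃ k ∈ {k | ¬ (interior (Z' k)).Nonempty}, Z' k with hG
    have hGd : Dense Gᶜ := by
      rw [hG, Set.compl_iUnion₂]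
      apply dense_biInter_of_isOpen
      · intro k _; exact (h1 k).1.isClosed.isOpen_compl
      · exact Set.to_countable _
      · intro k hk
        rw [← interior_eq_empty_iff_dense_compl]
        exact Set.not_nonempty_iff_eq_empty.1 hk
    have hCF : C ⊆ F := by
      have : C ⊆ closure (interior C) := by
        rw [hC.2.1.closure_interior_eq_closure_of_nonempty_interior hC.2.2]
        exact subset_closure
      refine this.trans ?_
      have : closure (interior C) ⊆ closure (interior C ∩ Gᶜ) :=
        closure_minimal (hGd.open_subset_closure_inter isOpen_interior) isClosed_closure
      refine this.trans (closure_minimal ?_ hFc)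
      rintro x ⟨hx, hxG⟩
      have hxC := interior_subset hx
      rw [← h3] at hxC
      obtain ⟨k, hk⟩ := Set.mem_iUnion.1 hxC
      by_cases hf : (interior (Z' k)).Nonempty
      · exact Set.mem_biUnion (show k ∈ {k | (interior (Z' k)).Nonempty} from hf) hk
      · exact absurd (Set.mem_biUnion (show k ∈ {k | ¬ (interior (Z' k)).Nonempty} from hf) hk) hxG
    intro p hp
    obtain ⟨k, hk, hpk⟩ := Set.mem_iUnion₂.1 (hCF hp)
    exact ⟨k, hk, hpk⟩
  have blank : ∀ h, ∃ k : Fin b, (interior (Z' (Fin.natAdd m k))).Nonempty ∧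
      pt h ∈ Z' (Fin.natAdd m k) := by
    intro h
    obtain ⟨k, hk, hp⟩ := fat _ (hpt h)
    induction k using Fin.addCases with
    | left i =>
      exfalso
      obtain ⟨j, hji, z, hz, hit⟩ := hA h i
      obtain ⟨w, hw, hwU⟩ := hit.mem (h1 _).2 hp (h4 i hz)
      refine key _ j ?_ hk w hw hwU
      intro e
      exact hji ((Fin.castAdd_injective m b e).symm)
    | right k => exact ⟨k, hk, hp⟩
  choose f hf1 hf2 using blank
  have inj : Function.Injective f := by
    intro h h' e
    by_contra hne
    obtain ⟨j, hit⟩ := hB h h' hne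
    have hp' := hf2 h'
    rw [← e] at hp'
    obtain ⟨w, hw, hwU⟩ := hit.mem (h1 _).2 (hf2 h) hp'
    refine key _ j ?_ (hf1 h) w hw hwU
    intro e'
    have := congrArg Fin.val e'
    simp at this
    omega
  simpa using Fintype.card_le_of_injective f inj

/-- the chosen points in the holes -/
noncomputable def pts (N : ℝ) (l : ℕ) : Unit ⊕ (Fin l ⊕ Fin l) → ℝ × ℝ
  | .inl _ => lefP N
  | .inr (.inl i) => topP (N + 4 * (i : ℕ))
  | .inr (.inr i) => botP (N + 4 * ((i : ℕ) + 1 : ℕ))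

lemma blocked {N : ℝ} {l : ℕ} (hN : 1000 * (l + 3) ≤ N) (h : Unit ⊕ (Fin l ⊕ Fin l)) (k : ℕ)
    (hk : k < l + 3) : ∃ j, j < l + 3 ∧ j ≠ k ∧ ∃ z ∈ Zf N k, Hit (pts N l h) z (Uf N j) := by
  have hl0 : (0:ℝ) ≤ l := Nat.cast_nonneg l
  have hN' : 1000 ≤ N := by linarith
  have bd : ∀ k : ℕ, k < l + 1 → N ≤ N + 4 * (k:ℝ) ∧ N + 4 * (k:ℝ) ≤ N + N / 100 := by
    intro k hk
    have h0 : (0:ℝ) ≤ k := Nat.cast_nonneg k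
    have : (k:ℝ) ≤ l := by exact_mod_cast (by omega : k ≤ l)
    constructor <;> linarith
  match h with
  | .inl _ =>
    match k, hk with
    | 0, _ => 
      refine ⟨2, by omega, by omega, ?_⟩
      simpa [Zf, Uf, pts] using lef_T hN'
    | 1, _ => exact ⟨0, by omega, by omega, lef_B hN'⟩
    | 2, _ =>
      refine ⟨1, by omega, by omega, ?_⟩
      simpa [Zf, Uf, pts] using lef_c hN'
    | k + 3, hk =>
      refine ⟨2, by omega, by omega, (N + 4 * ((k+1 : ℕ):ℝ), 0), ?_, ?_⟩
      · exact interior_subset (Uc_sub _ (center_mem (by linarith [(bd (k+1) (by omega)).1])))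
      · have := lef_cc hN' (bd (k+1) (by omega)).1
        simpa [Zf, Uf, pts] using this
  | .inr (.inl i) =>
    obtain ⟨b1, b2⟩ := bd i (by omega)
    match k, hk with
    | 0, _ =>
      refine ⟨(i:ℕ) + 1 + 2, by omega, by omega, ?_⟩
      have := top_T hN' b1 b2
      simp only [Zf, Uf, pts]
      convert this using 5
      push_cast; ring
    | 1, _ =>
      refine ⟨(i:ℕ) + 2, by omega, by omega,
        (N + 4 * (i:ℕ) + 3/2, -(N + 4 * (i:ℕ) + 2)^2 - 1/64), ?_, ?_⟩
      · simp only [Zf, B, Set.mem_ofPred_eq]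
        constructor <;> nlinarith
      · refine top_drop hN' b1 b2 ?_ ?_ ?_
        · simp only; linarith
        · simp only; linarith
        · simp only; nlinarith [sq_nonneg (N + 4 * ((i:ℕ):ℝ) + 2)]
    | k + 2, hk =>
      by_cases e : k = i
      · subst e
        exact ⟨0, by omega, by omega, top_c hN' b1 b2⟩
      · obtain ⟨c1, c2⟩ := bd k (by omega)
        refine ⟨(i:ℕ) + 2, by omega, by omega, (N + 4 * (k:ℝ), 0), ?_, ?_⟩
        · exact interior_subset (Uc_sub _ (center_mem (by linarith)))
        · refine top_drop hN' b1 b2 ?_ ?_ ?_ <;> simp only <;> linarith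
  | .inr (.inr i) =>
    obtain ⟨b1, b2⟩ := bd (i+1) (by omega)
    match k, hk with
    | 1, _ =>
      refine ⟨(i:ℕ) + 2, by omega, by omega, ?_⟩
      have := bot_B hN' b1 b2
      simp only [Zf, Uf, pts]
      convert this using 5
      push_cast; ring
    | 0, _ =>
      refine ⟨(i:ℕ) + 1 + 2, by omega, by omega,
        (N + 4 * ((i:ℕ) + 1 : ℕ) - 3/2, (N + 4 * ((i:ℕ) + 1 : ℕ) - 2)^2 + 1/64), ?_, ?_⟩
      · simp only [Zf, T, Set.mem_ofPred_eq]
        constructor <;> nlinarith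
      · refine bot_drop hN' b1 b2 ?_ ?_ ?_
        · simp only; linarith
        · simp only; linarith
        · simp only; positivity
    | k + 2, hk =>
      by_cases e : k = i + 1
      · subst e
        exact ⟨1, by omega, by omega, bot_c hN' b1 b2⟩
      · obtain ⟨c1, c2⟩ := bd k (by omega)
        refine ⟨(i:ℕ) + 1 + 2, by omega, by omega, (N + 4 * (k:ℝ), 0), ?_, ?_⟩
        · exact interior_subset (Uc_sub _ (center_mem (by linarith)))
        · refine bot_drop hN' b1 b2 ?_ ?_ ?_ <;> simp only <;> linarith

lemma tt {N : ℝ} {l : ℕ} (hN : 1000 * (l + 3) ≤ N) {i j : ℕ} (hij : i < j) (hj : j < l) :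
    ∃ k, k < l + 3 ∧ Hit (topP (N + 4 * i)) (topP (N + 4 * j)) (Uf N k) := by
  have hl0 : (0:ℝ) ≤ l := Nat.cast_nonneg l
  have hi0 : (0:ℝ) ≤ i := Nat.cast_nonneg i
  have hj0 : (j:ℝ) ≤ l := by exact_mod_cast hj.le
  rcases Nat.eq_or_lt_of_le (Nat.succ_le_of_lt hij) with e | e
  · refine ⟨j + 2, by omega, ?_⟩
    have := top_top_near (N := N) (X := N + 4 * i) (by linarith) (by linarith)
    rw [← e]
    simp only [Uf]
    convert this using 2 <;> push_cast <;> ring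
  · refine ⟨0, by omega, top_top_far (by linarith) (by linarith) ?_ (by linarith)⟩
    have : ((i + 2 : ℕ) : ℝ) ≤ j := by exact_mod_cast e
    push_cast at this
    linarith

lemma bb {N : ℝ} {l : ℕ} (hN : 1000 * (l + 3) ≤ N) {i j : ℕ} (hij : i < j) (hj : j < l + 1) :
    ∃ k, k < l + 3 ∧ Hit (botP (N + 4 * i)) (botP (N + 4 * j)) (Uf N k) := by
  have hl0 : (0:ℝ) ≤ l := Nat.cast_nonneg l
  have hi0 : (0:ℝ) ≤ i := Nat.cast_nonneg i
  have hj0 : (j:ℝ) ≤ l := by exact_mod_cast (by omega : j ≤ l)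
  rcases Nat.eq_or_lt_of_le (Nat.succ_le_of_lt hij) with e | e
  · refine ⟨i + 2, by omega, Hit.symm ?_⟩
    have := bot_bot_near (N := N) (X := N + 4 * i) (by linarith) (by linarith)
    rw [← e]
    simp only [Uf]
    convert this using 2 <;> push_cast <;> ring
  · refine ⟨1, by omega, bot_bot_far (by linarith) (by linarith) ?_ (by linarith)⟩
    have : ((i + 2 : ℕ) : ℝ) ≤ j := by exact_mod_cast e
    push_cast at this
    linarith

lemma tl {N : ℝ} {l : ℕ} (hN : 1000 * (l + 3) ≤ N) {i : ℕ} (hi : i < l) :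
    ∃ k, k < l + 3 ∧ Hit (topP (N + 4 * i)) (lefP N) (Uf N k) := by
  have hl0 : (0:ℝ) ≤ l := Nat.cast_nonneg l
  have hj0 : (i:ℝ) ≤ l := by exact_mod_cast hi.le
  rcases Nat.eq_zero_or_pos i with rfl | e
  · refine ⟨2, by omega, ?_⟩
    simpa [Uf] using top_lef_near (N := N) (by linarith)
  · have : (1:ℝ) ≤ i := by exact_mod_cast e
    exact ⟨0, by omega, top_lef_far (by linarith) (by linarith) (by linarith)⟩

lemma bl {N : ℝ} {l : ℕ} (hN : 1000 * (l + 3) ≤ N) {i : ℕ} (hi : i < l) :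
    ∃ k, k < l + 3 ∧ Hit (botP (N + 4 * (i + 1 : ℕ))) (lefP N) (Uf N k) := by
  have hl0 : (0:ℝ) ≤ l := Nat.cast_nonneg l
  have hj0 : (i:ℝ) + 1 ≤ l := by exact_mod_cast hi
  rcases Nat.eq_zero_or_pos i with rfl | e
  · refine ⟨2, by omega, ?_⟩
    simpa [Uf] using bot_lef_near (N := N) (by linarith)
  · have : (1:ℝ) ≤ i := by exact_mod_cast e
    refine ⟨1, by omega, bot_lef_far (by linarith) ?_ ?_⟩ <;> push_cast <;> linarith

lemma tb {N : ℝ} {l : ℕ} (hN : 1000 * (l + 3) ≤ N) {i j : ℕ} (hi : i < l) (hj : j < l + 1) :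
    ∃ k, k < l + 3 ∧ Hit (topP (N + 4 * i)) (botP (N + 4 * j)) (Uf N k) := by
  have hl0 : (0:ℝ) ≤ l := Nat.cast_nonneg l
  have hi0 : (0:ℝ) ≤ i := Nat.cast_nonneg i
  have hi1 : (i:ℝ) ≤ l := by exact_mod_cast hi.le
  have hj0 : (0:ℝ) ≤ j := Nat.cast_nonneg j
  have hj1 : (j:ℝ) ≤ l := by exact_mod_cast (by omega : j ≤ l)
  refine ⟨i + 2, by omega, top_drop (N := N) (by linarith) (by linarith) (by linarith) ?_ ?_ ?_⟩
  · simp only [botP]; linarith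
  · simp only [botP]; linarith
  · simp only [botP]; nlinarith [sq_nonneg (N + 4 * (j:ℝ) - 1)]

lemma separated {N : ℝ} {l : ℕ} (hN : 1000 * (l + 3) ≤ N) (h h' : Unit ⊕ (Fin l ⊕ Fin l))
    (hne : h ≠ h') : ∃ k, k < l + 3 ∧ Hit (pts N l h) (pts N l h') (Uf N k) := by
  have sy : ∀ {p q : ℝ × ℝ}, (∃ k, k < l + 3 ∧ Hit p q (Uf N k)) →
      ∃ k, k < l + 3 ∧ Hit q p (Uf N k) := fun ⟨k, hk, h⟩ => ⟨k, hk, h.symm⟩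
  match h, h' with
  | .inl _, .inl _ => exact absurd rfl hne
  | .inl _, .inr (.inl i) => exact sy (tl hN i.2)
  | .inl _, .inr (.inr i) => exact sy (bl hN i.2)
  | .inr (.inl i), .inl _ => exact tl hN i.2
  | .inr (.inr i), .inl _ => exact bl hN i.2
  | .inr (.inl i), .inr (.inr j) => exact tb hN i.2 (by omega)
  | .inr (.inr j), .inr (.inl i) => exact sy (tb hN i.2 (by omega))
  | .inr (.inl i), .inr (.inl j) =>
    have hij : (i:ℕ) ≠ j := fun e => hne (by rw [Fin.ext e])
    rcases lt_or_gt_of_ne hij with h | h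
    · exact tt hN h j.2
    · exact sy (tt hN h i.2)
  | .inr (.inr i), .inr (.inr j) =>
    have hij : (i:ℕ) ≠ j := fun e => hne (by rw [Fin.ext e])
    rcases lt_or_gt_of_ne hij with h | h
    · exact bb hN (by omega) (by omega)
    · exact sy (bb hN (by omega) (by omega))

lemma pts_mem {N : ℝ} {l : ℕ} (hN : 1000 * (l + 3) ≤ N) (h : Unit ⊕ (Fin l ⊕ Fin l)) :
    pts N l h ∈ cake ((10*N)^2) := by
  have hl0 : (0:ℝ) ≤ l := Nat.cast_nonneg l
  have hN' : 1000 ≤ N := by linarith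
  have bd : ∀ k : ℕ, k < l + 1 → N ≤ N + 4 * (k:ℝ) ∧ N + 4 * (k:ℝ) ≤ N + N / 100 := by
    intro k hk
    have h0 : (0:ℝ) ≤ k := Nat.cast_nonneg k
    have : (k:ℝ) ≤ l := by exact_mod_cast (by omega : k ≤ l)
    constructor <;> linarith
  rw [mem_cake]
  match h with
  | .inl _ =>
    simp only [pts, lefP]
    refine ⟨⟨?_, ?_⟩, ?_, ?_⟩ <;> nlinarith
  | .inr (.inl i) =>
    obtain ⟨b1, b2⟩ := bd i (by omega)
    simp only [pts, topP]
    refine ⟨⟨?_, ?_⟩, ?_, ?_⟩ <;> nlinarith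
  | .inr (.inr i) =>
    obtain ⟨b1, b2⟩ := bd (i+1) (by omega)
    simp only [pts, botP]
    refine ⟨⟨?_, ?_⟩, ?_, ?_⟩ <;> nlinarith

lemma Zf_body {N : ℝ} {l : ℕ} (hN : 1000 * (l + 3) ≤ N) {k : ℕ} (hk : k < l + 3) :
    IsConvexBody (Zf N k) ∧ Zf N k ⊆ cake ((10*N)^2) := by
  have hl0 : (0:ℝ) ≤ l := Nat.cast_nonneg l
  have hN' : 1000 ≤ N := by linarith
  have hM : 4 ≤ (10*N)^2 := by nlinarith
  match k, hk with
  | 0, _ => exact ⟨T_body hM, T_cake hM⟩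
  | 1, _ => exact ⟨B_body hM, B_cake hM⟩
  | k + 2, hk =>
    have h0 : (0:ℝ) ≤ k := Nat.cast_nonneg k
    have : (k:ℝ) ≤ l := by exact_mod_cast (by omega : k ≤ l)
    exact ⟨c_body hN' (by linarith) (by linarith), c_cake hN' (by linarith) (by linarith)⟩

end Cake

theorem convex_cake_lower_bound (m : ℕ) (hm : 3 ≤ m) :
    ∃ (C : Set (ℝ × ℝ)) (Z : Fin m → Set (ℝ × ℝ)),
      IsConvexBody C ∧
      (∀ i, IsConvexBody (Z i)) ∧
      (∀ i, Z i ⊆ C) ∧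
      (∀ i j, i ≠ j → Disjoint (Z i) (Z j)) ∧
      ∀ (b : ℕ) (Z' : Fin (m + b) → Set (ℝ × ℝ)),
        (∀ i, IsCompact (Z' i) ∧ Convex ℝ (Z' i)) →
        (∀ i j, i ≠ j → Disjoint (interior (Z' i)) (interior (Z' j))) →
        (⋃ i, Z' i) = C →
        (∀ i : Fin m, Z i ⊆ Z' (Fin.castAdd b i)) →
        2 * m - 5 ≤ b := by
  obtain ⟨l, rfl⟩ : ∃ l, m = l + 3 := ⟨m - 3, by omega⟩
  set N : ℝ := 1000 * (l + 3) with hNdef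
  have hN : 1000 * ((l:ℝ) + 3) ≤ N := le_refl _
  have hl0 : (0:ℝ) ≤ l := Nat.cast_nonneg l
  have hC : IsConvexBody (Cake.cake ((10*N)^2)) := Cake.cake_body (by
    have : 0 < N := by linarith
    positivity)
  refine ⟨Cake.cake ((10*N)^2), fun i => Cake.Zf N i, hC, fun i => (Cake.Zf_body hN i.2).1,
    fun i => (Cake.Zf_body hN i.2).2, ?_, ?_⟩
  · intro i j hij
    rcases lt_or_gt_of_ne hij with h | h
    · exact Cake.Zf_disj N h
    · exact (Cake.Zf_disj N h).symm
  · intro b Z' h1 h2 h3 h4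
    have := Cake.core (Z := fun i : Fin (l+3) => Cake.Zf N i) (U := fun i => Cake.Uf N i)
      (Cake.pts N l) hC (fun i => Cake.Uf_sub N i) (Cake.pts_mem hN)
      (fun h i => by
        obtain ⟨j, hj, hji, hz⟩ := Cake.blocked hN h i i.2
        exact ⟨⟨j, hj⟩, fun e => hji (congrArg Fin.val e), hz⟩)
      (fun h h' hne => by
        obtain ⟨j, hj, hz⟩ := Cake.separated hN h h' hne
        exact ⟨⟨j, hj⟩, hz⟩) Z' h1 h2 h3 h4
    simp at this
    omega
end

section
/- Let m ≥ 3 and let Z₁, …, Zₘ be pairwise interior-disjoint convex bodies in the plane ℝ². Then the set of connected components of the complement ℝ² \ (Z₁ ∪ ⋯ ∪ Zₘ) is finite and has at most 2m − 4 elements. -/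
open Set Filter Topology

namespace CH

/-- `z` avoids all the bodies. -/
def Fr {m : ℕ} (Z : Fin m → Set (ℝ × ℝ)) (z : ℝ × ℝ) : Prop := ∀ i, z ∉ Z i

/-- `H` is a hole of the family. -/
def IsHole {m : ℕ} (Z : Fin m → Set (ℝ × ℝ)) (H : Set (ℝ × ℝ)) : Prop :=
  ∃ x ∈ (⋃ i, Z i)ᶜ, H = connectedComponentIn (⋃ i, Z i)ᶜ x

/-- Points of `A` are weakly left of points of `B` at the same level. -/
def Lft (A B : Set (ℝ × ℝ)) : Prop := ∀ p ∈ A, ∀ q ∈ B, p.2 = q.2 → p.1 ≤ q.1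

/-- Normalised configurations: each body has a unique top point and a unique bottom point. -/
structure Cfg {m : ℕ} (Z : Fin m → Set (ℝ × ℝ)) (t b : Fin m → ℝ × ℝ) : Prop where
  comp : ∀ i, IsCompact (Z i)
  conv : ∀ i, Convex ℝ (Z i)
  tm : ∀ i, t i ∈ Z i
  bm : ∀ i, b i ∈ Z i
  tmax : ∀ i, ∀ p ∈ Z i, p.2 ≤ (t i).2
  bmin : ∀ i, ∀ p ∈ Z i, (b i).2 ≤ p.2
  tuniq : ∀ i, ∀ p ∈ Z i, p.2 = (t i).2 → p = t i
  buniq : ∀ i, ∀ p ∈ Z i, p.2 = (b i).2 → p = b i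
  bt : ∀ i, (b i).2 < (t i).2
  sec : ∀ i v, (b i).2 < v → v < (t i).2 → ∃ p ∈ Z i, ∃ q ∈ Z i, p.2 = v ∧ q.2 = v ∧ p.1 < q.1
  lr : ∀ i k, i ≠ k → Lft (Z i) (Z k) ∨ Lft (Z k) (Z i)

def RAdj (p : ℝ × ℝ) (H : Set (ℝ × ℝ)) : Prop := ∀ᶠ u in 𝓝[>] p.1, (u, p.2) ∈ H
def LAdj (p : ℝ × ℝ) (H : Set (ℝ × ℝ)) : Prop := ∀ᶠ u in 𝓝[<] p.1, (u, p.2) ∈ H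

/-- `O` is the outer hole. -/
def IsOut {m : ℕ} (Z : Fin m → Set (ℝ × ℝ)) (O : Set (ℝ × ℝ)) : Prop :=
  IsHole Z O ∧ ∃ M : ℝ, ∀ z : ℝ × ℝ, M ≤ ‖z‖ → z ∈ O

section basic
variable {m : ℕ} {Z : Fin m → Set (ℝ × ℝ)} {t b : Fin m → ℝ × ℝ} {H H' O : Set (ℝ × ℝ)}

lemma fr_iff {z : ℝ × ℝ} : z ∈ (⋃ i, Z i)ᶜ ↔ Fr Z z := by simp [Fr]

lemma IsHole.fr (hH : IsHole Z H) {z : ℝ × ℝ} (hz : z ∈ H) : Fr Z z := by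
  obtain ⟨x, hx, rfl⟩ := hH
  exact fr_iff.1 (connectedComponentIn_subset _ _ hz)

lemma IsHole.eq_comp (hH : IsHole Z H) {z : ℝ × ℝ} (hz : z ∈ H) :
    H = connectedComponentIn (⋃ i, Z i)ᶜ z := by
  obtain ⟨x, hx, rfl⟩ := hH
  exact connectedComponentIn_eq hz

lemma IsHole.eq_of_mem (hH : IsHole Z H) (hH' : IsHole Z H') {z : ℝ × ℝ} (hz : z ∈ H)
    (hz' : z ∈ H') : H = H' := by
  rw [hH.eq_comp hz, hH'.eq_comp hz']

lemma exists_hole {z : ℝ × ℝ} (hz : Fr Z z) : ∃ H, IsHole Z H ∧ z ∈ H :=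
  ⟨_, ⟨z, fr_iff.2 hz, rfl⟩, mem_connectedComponentIn (fr_iff.2 hz)⟩

lemma IsHole.nonempty (hH : IsHole Z H) : H.Nonempty := by
  obtain ⟨x, hx, rfl⟩ := hH
  exact ⟨x, mem_connectedComponentIn hx⟩

lemma IsHole.path (hH : IsHole Z H) {f : ℝ → ℝ × ℝ} (hf : Continuous f) {s s' : ℝ}
    (hfr : ∀ r ∈ uIcc s s', Fr Z (f r)) (hs : f s ∈ H) : f s' ∈ H := by
  rw [hH.eq_comp hs]
  have h1 : IsPreconnected (f '' uIcc s s') := isPreconnected_uIcc.image _ hf.continuousOn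
  refine h1.subset_connectedComponentIn (mem_image_of_mem _ left_mem_uIcc) ?_
    (mem_image_of_mem _ right_mem_uIcc)
  rintro _ ⟨r, hr, rfl⟩
  exact fr_iff.2 (hfr r hr)

lemma IsHole.horiz (hH : IsHole Z H) {u u' v : ℝ}
    (hfr : ∀ r ∈ uIcc u u', Fr Z (r, v)) (hs : (u, v) ∈ H) : (u', v) ∈ H :=
  hH.path (f := fun r => (r, v)) (by fun_prop) hfr hs

lemma IsHole.vert (hH : IsHole Z H) {u v v' : ℝ}
    (hfr : ∀ r ∈ uIcc v v', Fr Z (u, r)) (hs : (u, v) ∈ H) : (u, v') ∈ H :=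
  hH.path (f := fun r => (u, r)) (by fun_prop) hfr hs

lemma Cfg.isOpen_fr (h : Cfg Z t b) : IsOpen (⋃ i, Z i)ᶜ :=
  (isClosed_iUnion_of_finite fun i => (h.comp i).isClosed).isOpen_compl

lemma Cfg.isOpen (h : Cfg Z t b) (hH : IsHole Z H) : IsOpen H := by
  obtain ⟨x, hx, rfl⟩ := hH
  exact h.isOpen_fr.connectedComponentIn

lemma row {A : Set (ℝ × ℝ)} (hA : Convex ℝ A) {c d : ℝ × ℝ} (hc : c ∈ A) (hd : d ∈ A)
    (hcd : c.2 = d.2) {u : ℝ} (h1 : c.1 ≤ u) (h2 : u ≤ d.1) : (u, c.2) ∈ A := by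
  rcases eq_or_lt_of_le (h1.trans h2) with h | h
  · have : (u, c.2) = c := by ext <;> simp; linarith
    rwa [this]
  · have hpos : 0 < d.1 - c.1 := by linarith
    have := hA hc hd (a := (d.1 - u) / (d.1 - c.1)) (b := (u - c.1) / (d.1 - c.1))
      (div_nonneg (by linarith) hpos.le) (div_nonneg (by linarith) hpos.le)
      (by field_simp; ring)
    convert this using 1
    ext
    · simp; field_simp; ring
    · simp [← hcd]; field_simp; ring

lemma interp {A : Set (ℝ × ℝ)} (hA : Convex ℝ A) {c d : ℝ × ℝ} (hc : c ∈ A) (hd : d ∈ A)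
    {v : ℝ} (h1 : c.2 ≤ v) (h2 : v ≤ d.2) : ∃ e ∈ A, e.2 = v := by
  rcases eq_or_lt_of_le (h1.trans h2) with h | h
  · exact ⟨c, hc, by linarith⟩
  · have hpos : 0 < d.2 - c.2 := by linarith
    refine ⟨_, hA hc hd (a := (d.2 - v) / (d.2 - c.2)) (b := (v - c.2) / (d.2 - c.2))
      (div_nonneg (by linarith) hpos.le) (div_nonneg (by linarith) hpos.le)
      (by field_simp; ring), ?_⟩
    simp; field_simp; ring

/-- If a convex set has a lower point, and a point at level `v` left of `u`, then it has points
left of `u` at levels slightly below `v`. -/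
lemma interp_ev {A : Set (ℝ × ℝ)} (hA : Convex ℝ A) {c d : ℝ × ℝ} (hc : c ∈ A) (hd : d ∈ A)
    (hcd : c.2 < d.2) {u : ℝ} (hu : d.1 < u) :
    ∀ᶠ v in 𝓝[<] d.2, ∃ e ∈ A, e.2 = v ∧ e.1 < u := by
  have hpos : 0 < d.2 - c.2 := by linarith
  have hcont : Continuous fun v : ℝ => d.1 + (d.2 - v) / (d.2 - c.2) * (c.1 - d.1) := by fun_prop
  have h1 : ∀ᶠ v in 𝓝 d.2, d.1 + (d.2 - v) / (d.2 - c.2) * (c.1 - d.1) < u := by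
    apply hcont.continuousAt.eventually_lt_const
    simpa using hu
  filter_upwards [h1.filter_mono nhdsWithin_le_nhds, Ioo_mem_nhdsLT hcd] with v hv hv'
  refine ⟨_, hA hc hd (a := (d.2 - v) / (d.2 - c.2)) (b := (v - c.2) / (d.2 - c.2))
      (div_nonneg (by linarith [hv'.2]) hpos.le) (div_nonneg (by linarith [hv'.1]) hpos.le)
      (by field_simp; ring), ?_, ?_⟩
  · simp; field_simp; ring
  · convert hv using 1
    simp; field_simp; ring

lemma interp_ev_right {A : Set (ℝ × ℝ)} (hA : Convex ℝ A) {c d : ℝ × ℝ} (hc : c ∈ A) (hd : d ∈ A)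
    (hcd : c.2 < d.2) {u : ℝ} (hu : u < d.1) :
    ∀ᶠ v in 𝓝[<] d.2, ∃ e ∈ A, e.2 = v ∧ u < e.1 := by
  have hpos : 0 < d.2 - c.2 := by linarith
  have hcont : Continuous fun v : ℝ => d.1 + (d.2 - v) / (d.2 - c.2) * (c.1 - d.1) := by fun_prop
  have h1 : ∀ᶠ v in 𝓝 d.2, u < d.1 + (d.2 - v) / (d.2 - c.2) * (c.1 - d.1) := by
    apply hcont.continuousAt.eventually_const_lt
    simpa using hu
  filter_upwards [h1.filter_mono nhdsWithin_le_nhds, Ioo_mem_nhdsLT hcd] with v hv hv'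
  refine ⟨_, hA hc hd (a := (d.2 - v) / (d.2 - c.2)) (b := (v - c.2) / (d.2 - c.2))
      (div_nonneg (by linarith [hv'.2]) hpos.le) (div_nonneg (by linarith [hv'.1]) hpos.le)
      (by field_simp; ring), ?_, ?_⟩
  · simp; field_simp; ring
  · convert hv using 1
    simp; field_simp; ring

lemma IsOut.left (hO : IsOut Z O) {z : ℝ × ℝ} (hz : ∀ u ≤ z.1, Fr Z (u, z.2)) : z ∈ O := by
  obtain ⟨hH, M, hM⟩ := hO
  have h1 : (min z.1 (-|M|), z.2) ∈ O := by
    apply hM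
    rw [Prod.norm_def]
    refine le_max_of_le_left ?_
    have : min z.1 (-|M|) ≤ -|M| := min_le_right _ _
    have h2 := neg_le_abs (min z.1 (-|M|))
    rw [Real.norm_eq_abs]
    show M ≤ |min z.1 (-|M|)|
    linarith [le_abs_self M]
  refine hH.horiz (u' := z.1) ?_ h1
  intro r hr
  rw [uIcc_of_le (min_le_left _ _)] at hr
  exact hz r hr.2

lemma IsOut.right (hO : IsOut Z O) {z : ℝ × ℝ} (hz : ∀ u ≥ z.1, Fr Z (u, z.2)) : z ∈ O := by
  obtain ⟨hH, M, hM⟩ := hO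
  have h1 : (max z.1 (|M|), z.2) ∈ O := by
    apply hM
    rw [Prod.norm_def]
    refine le_max_of_le_left ?_
    have : |M| ≤ max z.1 (|M|) := le_max_right _ _
    have h2 := le_abs_self (max z.1 (|M|))
    rw [Real.norm_eq_abs]
    show M ≤ |max z.1 (|M|)|
    linarith [le_abs_self M]
  refine hH.horiz (u' := z.1) ?_ h1
  intro r hr
  rw [uIcc_of_ge (le_max_left _ _)] at hr
  exact hz r hr.1

lemma Cfg.exists_out (h : Cfg Z t b) : ∃ O, IsOut Z O := by
  have hc : IsCompact (⋃ i, Z i) := isCompact_iUnion h.comp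
  obtain ⟨R, hR⟩ := hc.isBounded.exists_norm_le
  set M : ℝ := |R| + 1 with hMdef
  have hM0 : 0 < M := by positivity
  have hfr : ∀ z : ℝ × ℝ, (M ≤ |z.1| ∨ M ≤ |z.2|) → Fr Z z := by
    intro z hz i hi
    have h1 := hR z (mem_iUnion.2 ⟨i, hi⟩)
    rw [Prod.norm_def, max_le_iff, Real.norm_eq_abs, Real.norm_eq_abs] at h1
    rcases hz with hz | hz <;> linarith [le_abs_self R, h1.1, h1.2]
  obtain ⟨O, hO, hMO⟩ := exists_hole (hfr (M, M) (Or.inl (le_abs_self M)))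
  have hx1 : ∀ v, (M, v) ∈ O := fun v =>
    hO.vert (fun r _ => hfr _ (Or.inl (le_abs_self M))) hMO
  have hy1 : ∀ u, (u, M) ∈ O := fun v =>
    hO.horiz (fun r _ => hfr _ (Or.inr (le_abs_self M))) hMO
  have hx2 : ∀ v, (-M, v) ∈ O := fun v =>
    hO.vert (fun r _ => hfr _ (Or.inl (by simp [le_abs_self]))) (hy1 (-M))
  have hy2 : ∀ u, (u, -M) ∈ O := fun v =>
    hO.horiz (fun r _ => hfr _ (Or.inr (by simp [le_abs_self]))) (hx1 (-M))
  refine ⟨O, hO, M, fun z hz => ?_⟩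
  rw [Prod.norm_def, le_max_iff, Real.norm_eq_abs, Real.norm_eq_abs, le_abs, le_abs] at hz
  rcases hz with (hz | hz) | (hz | hz)
  · refine hO.horiz (u := M) (u' := z.1) (fun r hr => hfr _ (Or.inl ?_)) (hx1 z.2)
    rw [uIcc_of_le hz] at hr
    exact hr.1.trans (le_abs_self _)
  · refine hO.horiz (u := -M) (u' := z.1) (fun r hr => hfr _ (Or.inl ?_)) (hx2 z.2)
    rw [uIcc_of_ge (by linarith)] at hr
    exact le_abs.2 (Or.inr (by linarith [hr.2]))
  · refine hO.vert (v := M) (v' := z.2) (fun r hr => hfr _ (Or.inr ?_)) (hy1 z.1)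
    rw [uIcc_of_le hz] at hr
    exact hr.1.trans (le_abs_self _)
  · refine hO.vert (v := -M) (v' := z.2) (fun r hr => hfr _ (Or.inr ?_)) (hy2 z.1)
    rw [uIcc_of_ge (by linarith)] at hr
    exact le_abs.2 (Or.inr (by linarith [hr.2]))

end basic

section flips
variable {m : ℕ} {Z : Fin m → Set (ℝ × ℝ)} {t b : Fin m → ℝ × ℝ} {H H' O : Set (ℝ × ℝ)}

lemma IsHole.preimage (e : ℝ × ℝ ≃ₜ ℝ × ℝ) (hH : IsHole Z H) :
    IsHole (fun i => e ⁻¹' Z i) (e ⁻¹' H) := by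
  obtain ⟨x, hx, rfl⟩ := hH
  have h1 : (⋃ i, e ⁻¹' Z i)ᶜ = e.symm '' (⋃ i, Z i)ᶜ := by
    rw [e.image_symm, preimage_compl, preimage_iUnion]
  refine ⟨e.symm x, ?_, ?_⟩
  · rw [h1]; exact mem_image_of_mem _ hx
  · rw [h1, ← e.symm.image_connectedComponentIn hx, e.image_symm]

/-- The vertical flip. -/
def V : ℝ × ℝ ≃ₜ ℝ × ℝ := (Homeomorph.refl ℝ).prodCongr (Homeomorph.neg ℝ)
/-- The horizontal flip. -/
def W : ℝ × ℝ ≃ₜ ℝ × ℝ := (Homeomorph.neg ℝ).prodCongr (Homeomorph.refl ℝ)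

@[simp] lemma V_apply (z : ℝ × ℝ) : V z = (z.1, -z.2) := rfl
@[simp] lemma W_apply (z : ℝ × ℝ) : W z = (-z.1, z.2) := rfl

lemma V_inv (z : ℝ × ℝ) : V (V z) = z := by simp
lemma W_inv (z : ℝ × ℝ) : W (W z) = z := by simp

lemma V_lin : IsLinearMap ℝ V :=
  ⟨fun x y => by ext <;> simp; ring, fun c x => by ext <;> simp⟩
lemma W_lin : IsLinearMap ℝ W :=
  ⟨fun x y => by ext <;> simp; ring, fun c x => by ext <;> simp⟩

lemma Cfg.flipV (h : Cfg Z t b) :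
    Cfg (fun i => V ⁻¹' Z i) (fun i => V (b i)) (fun i => V (t i)) where
  comp i := V.isCompact_preimage.2 (h.comp i)
  conv i := (h.conv i).is_linear_preimage V_lin
  tm i := by rw [mem_preimage, V_inv]; exact h.bm i
  bm i := by rw [mem_preimage, V_inv]; exact h.tm i
  tmax i p hp := by have := h.bmin i _ hp; simp at this ⊢; linarith
  bmin i p hp := by have := h.tmax i _ hp; simp at this ⊢; linarith
  tuniq i p hp hpe := by
    have := h.buniq i _ hp (by simp at hpe ⊢; linarith)
    rw [← this, V_inv]
  buniq i p hp hpe := by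
    have := h.tuniq i _ hp (by simp at hpe ⊢; linarith)
    rw [← this, V_inv]
  bt i := by have := h.bt i; simp; linarith
  sec i v h1 h2 := by
    obtain ⟨p, hp, q, hq, h3, h4, h5⟩ :=
      h.sec i (-v) (by simp at h2; linarith) (by simp at h1; linarith)
    refine ⟨V p, by rw [mem_preimage, V_inv]; exact hp, V q,
      by rw [mem_preimage, V_inv]; exact hq, by simp [h3], by simp [h4], by simpa using h5⟩
  lr i k hik := by
    rcases h.lr i k hik with h1 | h1
    · exact Or.inl fun p hp q hq hpq => by
        simpa using h1 _ hp _ hq (by simp [hpq])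
    · exact Or.inr fun p hp q hq hpq => by
        simpa using h1 _ hp _ hq (by simp [hpq])

lemma Cfg.flipW (h : Cfg Z t b) :
    Cfg (fun i => W ⁻¹' Z i) (fun i => W (t i)) (fun i => W (b i)) where
  comp i := W.isCompact_preimage.2 (h.comp i)
  conv i := (h.conv i).is_linear_preimage W_lin
  tm i := by rw [mem_preimage, W_inv]; exact h.tm i
  bm i := by rw [mem_preimage, W_inv]; exact h.bm i
  tmax i p hp := by have := h.tmax i _ hp; simp at this ⊢; linarith
  bmin i p hp := by have := h.bmin i _ hp; simp at this ⊢; linarith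
  tuniq i p hp hpe := by
    have := h.tuniq i _ hp (by simp at hpe ⊢; linarith)
    rw [← this, W_inv]
  buniq i p hp hpe := by
    have := h.buniq i _ hp (by simp at hpe ⊢; linarith)
    rw [← this, W_inv]
  bt i := by have := h.bt i; simp; linarith
  sec i v h1 h2 := by
    obtain ⟨p, hp, q, hq, h3, h4, h5⟩ :=
      h.sec i v (by simp at h1; linarith) (by simp at h2; linarith)
    refine ⟨W q, by rw [mem_preimage, W_inv]; exact hq, W p,
      by rw [mem_preimage, W_inv]; exact hp, by simp [h4], by simp [h3], by simpa using h5⟩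
  lr i k hik := by
    rcases h.lr i k hik with h1 | h1
    · exact Or.inr fun p hp q hq hpq => by
        simpa using h1 _ hq _ hp (by simp [hpq])
    · exact Or.inl fun p hp q hq hpq => by
        simpa using h1 _ hq _ hp (by simp [hpq])

lemma IsOut.flipV (hO : IsOut Z O) : IsOut (fun i => V ⁻¹' Z i) (V ⁻¹' O) := by
  obtain ⟨h1, M, hM⟩ := hO
  exact ⟨h1.preimage V, M, fun z hz => hM _ (by simpa [Prod.norm_def] using hz)⟩

lemma IsOut.flipW (hO : IsOut Z O) : IsOut (fun i => W ⁻¹' Z i) (W ⁻¹' O) := by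
  obtain ⟨h1, M, hM⟩ := hO
  exact ⟨h1.preimage W, M, fun z hz => hM _ (by simpa [Prod.norm_def] using hz)⟩

@[simp] lemma RAdj_V {p : ℝ × ℝ} : RAdj (V p) (V ⁻¹' H) ↔ RAdj p H := by
  simp [RAdj]
@[simp] lemma LAdj_V {p : ℝ × ℝ} : LAdj (V p) (V ⁻¹' H) ↔ LAdj p H := by
  simp [LAdj]
@[simp] lemma RAdj_W {p : ℝ × ℝ} : RAdj (W p) (W ⁻¹' H) ↔ LAdj p H := by
  simp only [RAdj, LAdj, W_apply, mem_preimage]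
  rw [← neg_nhdsLT (a := p.1)]
  simp [← Filter.map_neg, Filter.eventually_map]
@[simp] lemma LAdj_W {p : ℝ × ℝ} : LAdj (W p) (W ⁻¹' H) ↔ RAdj p H := by
  simp only [RAdj, LAdj, W_apply, mem_preimage]
  rw [← neg_nhdsGT (a := p.1)]
  simp [← Filter.map_neg, Filter.eventually_map]

lemma pre_V_V (H : Set (ℝ × ℝ)) : V ⁻¹' (V ⁻¹' H) = H := by ext z; simp
lemma pre_W_W (H : Set (ℝ × ℝ)) : W ⁻¹' (W ⁻¹' H) = H := by ext z; simp

end flips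

lemma strict_sep {A B : Set (ℝ × ℝ)} (hA : IsCompact A) (hB : IsCompact B) (hAc : Convex ℝ A)
    (hBc : Convex ℝ B) {a c y : ℝ} (ha : (a, y) ∈ A) (hc : (c, y) ∈ B) (hac : a < c)
    (hdis : ∀ p ∈ A, p ∈ B → ¬ y ≤ p.2) :
    ∃ α β : ℝ, (∀ p ∈ A, y ≤ p.2 → p.1 < α + β * p.2) ∧
      (∀ p ∈ B, y ≤ p.2 → α + β * p.2 < p.1) := by
  have hcl : IsClosed {p : ℝ × ℝ | y ≤ p.2} := isClosed_le continuous_const continuous_snd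
  have hcv : Convex ℝ {p : ℝ × ℝ | y ≤ p.2} :=
    convex_halfSpace_ge (f := fun p : ℝ × ℝ => p.2) ⟨fun _ _ => rfl, fun _ _ => rfl⟩ y
  obtain ⟨f, u, v, hu, huv, hv⟩ := geometric_hahn_banach_compact_closed
    (hAc.inter hcv) (hA.inter_right hcl) (hBc.inter hcv) (hB.inter_right hcl).isClosed
    (by
      rw [Set.disjoint_left]
      rintro p ⟨hp, hp2⟩ ⟨hp', _⟩
      exact hdis p hp hp' hp2)
  have hf : ∀ p : ℝ × ℝ, f p = p.1 * f (1, 0) + p.2 * f (0, 1) := by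
    intro p
    have : p = p.1 • ((1 : ℝ), (0 : ℝ)) + p.2 • ((0 : ℝ), (1 : ℝ)) := by ext <;> simp
    conv_lhs => rw [this]
    rw [map_add, map_smul, map_smul, smul_eq_mul, smul_eq_mul]
  have h1 := hu _ ⟨ha, le_refl y⟩
  have h2 := hv _ ⟨hc, le_refl y⟩
  rw [hf] at h1 h2
  simp only at h1 h2
  set k := f (1, 0)
  set l := f (0, 1)
  have hk : 0 < k := by
    by_contra hk
    push Not at hk
    nlinarith
  refine ⟨u / k, - l / k, fun p hp hy => ?_, fun p hp hy => ?_⟩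
  · have := hu _ ⟨hp, hy⟩
    rw [hf] at this
    have h3 : u / k + -l / k * p.2 = (u - l * p.2) / k := by ring
    rw [h3, lt_div_iff₀ hk]; linarith
  · have := hv _ ⟨hp, hy⟩
    rw [hf] at this
    have h3 : u / k + -l / k * p.2 = (u - l * p.2) / k := by ring
    rw [h3, div_lt_iff₀ hk]; linarith

/-- `(u, v)` lies strictly between `A` and `B` at level `v`. -/
def Gap (A B : Set (ℝ × ℝ)) (u v : ℝ) : Prop :=
  ((∃ c ∈ A, c.2 = v ∧ c.1 < u) ∧ (u, v) ∉ A) ∧ ((∃ d ∈ B, d.2 = v ∧ u < d.1) ∧ (u, v) ∉ B)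

lemma Gap.mid {A B : Set (ℝ × ℝ)} (hA : Convex ℝ A) (hB : Convex ℝ B) {u u' w v : ℝ}
    (h : Gap A B u v) (h' : Gap A B u' v) (hw : w ∈ uIcc u u') : Gap A B w v := by
  wlog huu : u ≤ u' generalizing u u'
  · exact this h' h (uIcc_comm u u' ▸ hw) (le_of_not_ge huu)
  rw [uIcc_of_le huu] at hw
  obtain ⟨⟨⟨c, hc, hcv, hcu⟩, hnA⟩, _⟩ := h
  obtain ⟨_, ⟨d, hd, hdv, hdu⟩, hnB⟩ := h'
  refine ⟨⟨⟨c, hc, hcv, hcu.trans_le hw.1⟩, fun hwA => hnA ?_⟩,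
    ⟨d, hd, hdv, hw.2.trans_lt hdu⟩, fun hwB => hnB ?_⟩
  · have := row hA hc hwA hcv hcu.le hw.1
    rwa [hcv] at this
  · exact row hB hwB hd hdv.symm hw.2 hdu.le

section cover
variable {m : ℕ} {Z : Fin m → Set (ℝ × ℝ)} {t b : Fin m → ℝ × ℝ} {H H' O : Set (ℝ × ℝ)}

lemma Cfg.cover_up (h : Cfg Z t b) (hH : IsHole Z H) {x y a c : ℝ} {i j : Fin m}
    (hz : (x, y) ∈ H) (hax : a < x) (hxc : x < c) (hai : (a, y) ∈ Z i) (hcj : (c, y) ∈ Z j)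
    (hfree : ∀ u, a < u → u < c → Fr Z (u, y))
    (hgt : ∀ k, y ≠ (t k).2) (hgb : ∀ k, y ≠ (b k).2)
    (hdis : ∀ p ∈ Z i, p ∈ Z j → ¬ y ≤ p.2) :
    ∃ k, (RAdj (t k) H ∨ LAdj (t k) H) ∨ (RAdj (b k) H ∨ LAdj (b k) H) := by
  classical
  obtain ⟨α, β, hA, hB⟩ := strict_sep (h.comp i) (h.comp j) (h.conv i) (h.conv j) hai hcj
    (hax.trans hxc) hdis
  have hyi : y < (t i).2 := lt_of_le_of_ne (h.tmax i _ hai) (hgt i)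
  have hyj : y < (t j).2 := lt_of_le_of_ne (h.tmax j _ hcj) (hgt j)
  -- sections are nonempty
  have hsi : ∀ v, y ≤ v → v ≤ (t i).2 → ∃ e ∈ Z i, e.2 = v :=
    fun v h1 h2 => interp (h.conv i) hai (h.tm i) h1 h2
  have hsj : ∀ v, y ≤ v → v ≤ (t j).2 → ∃ e ∈ Z j, e.2 = v :=
    fun v h1 h2 => interp (h.conv j) hcj (h.tm j) h1 h2
  -- the line lies in the gap
  have hline : ∀ v, y ≤ v → v ≤ (t i).2 → v ≤ (t j).2 → Gap (Z i) (Z j) (α + β * v) v := by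
    intro v h1 h2 h3
    obtain ⟨e, he, hev⟩ := hsi v h1 h2
    obtain ⟨d, hd, hdv⟩ := hsj v h1 h3
    refine ⟨⟨⟨e, he, hev, ?_⟩, fun hh => ?_⟩, ⟨d, hd, hdv, ?_⟩, fun hh => ?_⟩
    · have := hA e he (by linarith); rwa [hev] at this
    · exact lt_irrefl _ (hA _ hh h1)
    · have := hB d hd (by linarith); rwa [hdv] at this
    · exact lt_irrefl _ (hB _ hh h1)
  -- bodies entering the gap have their bottom in the gap
  let S : Fin m → Prop := fun k => ∃ u v, y < v ∧ v ≤ (t i).2 ∧ v ≤ (t j).2 ∧ (u, v) ∈ Z k ∧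
    Gap (Z i) (Z j) u v
  have hS : ∀ k, S k → y < (b k).2 ∧ Lft (Z i) (Z k) ∧ Lft (Z k) (Z j) := by
    rintro k ⟨u, v, hyv, hvi, hvj, hk, hgap⟩
    have hki : k ≠ i := by rintro rfl; exact hgap.1.2 hk
    have hkj : k ≠ j := by rintro rfl; exact hgap.2.2 hk
    obtain ⟨⟨⟨e, he, hev, heu⟩, _⟩, ⟨d, hd, hdv, hdu⟩, _⟩ := hgap
    have hL1 : Lft (Z i) (Z k) := by
      rcases h.lr i k hki.symm with hl | hl
      · exact hl
      · have := hl _ hk e he hev.symm; simp only at this; linarith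
    have hL2 : Lft (Z k) (Z j) := by
      rcases h.lr k j hkj with hl | hl
      · exact hl
      · have := hl d hd _ hk hdv; simp only at this; linarith
    refine ⟨?_, hL1, hL2⟩
    by_contra hle
    have hlt : (b k).2 < y := lt_of_le_of_ne (not_lt.1 hle) (hgb k).symm
    have hlt2 : y < (t k).2 := hyv.trans_le (h.tmax k _ hk)
    obtain ⟨p, hp, q, hq, hpy, hqy, hpq⟩ := h.sec k y hlt hlt2
    have h1 : a ≤ p.1 := hL1 _ hai p hp hpy.symm
    have h2 : q.1 ≤ c := hL2 q hq _ hcj hqy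
    refine hfree ((p.1 + q.1) / 2) (by linarith) (by linarith) k ?_
    have := row (h.conv k) hp hq (hpy.trans hqy.symm) (u := (p.1 + q.1) / 2)
      (by linarith) (by linarith)
    rwa [hpy] at this
  -- the event
  obtain ⟨v', hyv, hvi, hvj, hSv, p, hpE, hpv, hpl, hpr⟩ : ∃ v', y < v' ∧ v' ≤ (t i).2 ∧
      v' ≤ (t j).2 ∧ (∀ k, S k → v' ≤ (b k).2) ∧ ∃ p, (∃ k, p = t k ∨ p = b k) ∧ p.2 = v' ∧
      (p.1 < α + β * v' → ∀ e ∈ Z i, e.2 = v' → e.1 ≤ p.1) ∧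
      (α + β * v' < p.1 → ∀ e ∈ Z j, e.2 = v' → p.1 ≤ e.1) := by
    have key : ∃ v', y < v' ∧ v' ≤ (t i).2 ∧
      v' ≤ (t j).2 ∧ ∃ p, (∃ k, p = t k ∨ p = b k) ∧ p.2 = v' ∧
      (p.1 < α + β * v' → ∀ e ∈ Z i, e.2 = v' → e.1 ≤ p.1) ∧
      (α + β * v' < p.1 → ∀ e ∈ Z j, e.2 = v' → p.1 ≤ e.1) := by
      rcases le_total (t i).2 (t j).2 with hle | hle
      · refine ⟨(t i).2, hyi, le_rfl, hle, t i, ⟨i, Or.inl rfl⟩, rfl, ?_, ?_⟩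
        · intro _ e he hee; rw [h.tuniq i e he hee]
        · intro hh; have := hA _ (h.tm i) hyi.le; linarith
      · refine ⟨(t j).2, hyj, hle, le_rfl, t j, ⟨j, Or.inl rfl⟩, rfl, ?_, ?_⟩
        · intro hh; have := hB _ (h.tm j) hyj.le; linarith
        · intro _ e he hee; rw [h.tuniq j e he hee]
    by_cases hne : ∃ k, S k ∧ (b k).2 ≤ (t i).2 ∧ (b k).2 ≤ (t j).2
    · obtain ⟨k, hk0, hkmin⟩ := Finset.exists_min_image
        (Finset.univ.filter fun k => S k ∧ (b k).2 ≤ (t i).2 ∧ (b k).2 ≤ (t j).2)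
        (fun k => (b k).2) (by obtain ⟨k, hk⟩ := hne; exact ⟨k, by simpa using hk⟩)
      simp only [Finset.mem_filter, Finset.mem_univ, true_and] at hk0
      obtain ⟨hk, hki, hkj⟩ := hk0
      obtain ⟨g1, g2, g3⟩ := hS k hk
      refine ⟨(b k).2, g1, hki, hkj, ?_, b k, ⟨k, Or.inr rfl⟩, rfl, ?_, ?_⟩
      · intro k' hk'
        by_cases hc' : (b k').2 ≤ (t i).2 ∧ (b k').2 ≤ (t j).2
        · exact hkmin k' (by simpa using ⟨hk', hc'⟩)
        · rw [not_and_or] at hc'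
          rcases hc' with hc' | hc' <;> linarith
      · intro _ e he hee; exact g2 e he _ (h.bm k) hee
      · intro _ e he hee; exact g3 _ (h.bm k) e he hee.symm
    · obtain ⟨v', h1, h2, h3, h4⟩ := key
      refine ⟨v', h1, h2, h3, ?_, h4⟩
      intro k hk
      by_contra hlt
      exact hne ⟨k, hk, by linarith, by linarith⟩
  -- the gap is free below the event
  have hgf : ∀ u v, y < v → v ≤ v' → Gap (Z i) (Z j) u v → ∀ k, (u, v) ∈ Z k →
      (u, v) = b k := by
    intro u v h1 h2 hg k hk
    have hSk : S k := ⟨u, v, h1, h2.trans hvi, h2.trans hvj, hk, hg⟩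
    have h3 := hSv k hSk
    have h4 := h.bmin k _ hk
    exact h.buniq k _ hk (by simp only at h4 ⊢; linarith)
  have hgf' : ∀ u v, y < v → v < v' → Gap (Z i) (Z j) u v → Fr Z (u, v) := by
    intro u v h1 h2 hg k hk
    have hSk : S k := ⟨u, v, h1, h2.le.trans hvi, h2.le.trans hvj, hk, hg⟩
    have h3 := hSv k hSk
    have h5 := hgf u v h1 h2.le hg k hk
    rw [← h5] at h3
    simp only at h3
    linarith
  have hσy := hline y le_rfl hyi.le hyj.le
  have hac1 : a < α + β * y := hA _ hai le_rfl
  have hac2 : α + β * y < c := hB _ hcj le_rfl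
  have h0 : (α + β * y, y) ∈ H := by
    refine hH.horiz (u := x) ?_ hz
    intro r hr
    rw [mem_uIcc] at hr
    apply hfree <;> rcases hr with hr | hr <;> linarith [hr.1, hr.2]
  have h1 : ∀ v, y < v → v < v' → (α + β * v, v) ∈ H := by
    intro v hv1 hv2
    refine hH.path (f := fun r => (α + β * r, r)) (s := y) (by fun_prop) ?_ h0
    intro r hr
    rw [uIcc_of_le hv1.le] at hr
    rcases eq_or_lt_of_le hr.1 with h3 | h3
    · subst h3; exact hH.fr h0
    · exact hgf' _ _ h3 (by linarith [hr.2]) (hline r h3.le (by linarith [hr.2])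
        (by linarith [hr.2]))
  have h2 : ∀ u v, y < v → v < v' → Gap (Z i) (Z j) u v → (u, v) ∈ H := by
    intro u v hv1 hv2 hg
    refine hH.horiz (u := α + β * v) ?_ (h1 v hv1 hv2)
    intro r hr
    exact hgf' _ _ hv1 hv2
      (Gap.mid (h.conv i) (h.conv j) (hline v hv1.le (by linarith) (by linarith)) hg hr)
  have h3 : ∀ u, Gap (Z i) (Z j) u v' → Fr Z (u, v') → (u, v') ∈ H := by
    intro u hg hfr
    obtain ⟨H2, hH2, hm2⟩ := exists_hole hfr
    have e1 : ∀ᶠ v in 𝓝[<] v', (u, v) ∈ H2 := by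
      have : ContinuousAt (fun v : ℝ => (u, v)) v' := by fun_prop
      exact (this.eventually ((h.isOpen hH2).mem_nhds hm2)).filter_mono nhdsWithin_le_nhds
    obtain ⟨⟨⟨e, he, hev, heu⟩, _⟩, ⟨d, hd, hdv, hdu⟩, _⟩ := hg
    have e2 := interp_ev (h.conv i) hai he (by simp only; linarith) heu
    have e3 := interp_ev_right (h.conv j) hcj hd (by simp only; linarith) hdu
    rw [hev] at e2
    rw [hdv] at e3
    obtain ⟨v, f1, f2, f3, f4⟩ := (e1.and (e2.and (e3.and (Ioo_mem_nhdsLT hyv)))).exists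
    have hfr' := hH2.fr f1
    have := h2 u v f4.1 f4.2 ⟨⟨f2, hfr' i⟩, f3, hfr' j⟩
    rw [hH.eq_of_mem hH2 this f1]
    exact hm2
  have hgood : ∀ u, Gap (Z i) (Z j) u v' → (∀ k, u ≠ (b k).1) → (u, v') ∈ H := by
    intro u hg hu
    refine h3 u hg fun k hk => hu k ?_
    rw [← hgf u v' hyv le_rfl hg k hk]
  have havoid : ∀ s : Set ℝ, p.1 ∉ s → ∀ᶠ u in 𝓝[s] p.1, ∀ k, u ≠ (b k).1 := by
    intro s hs
    rw [eventually_all]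
    intro k
    by_cases hk : p.1 = (b k).1
    · filter_upwards [self_mem_nhdsWithin] with u hu he
      exact hs (hk ▸ he ▸ hu)
    · exact nhdsWithin_le_nhds (isOpen_ne.mem_nhds hk)
  obtain ⟨⟨⟨e, he, hev, heu⟩, hne⟩, ⟨d, hd, hdv, hdu⟩, hnd⟩ := hline v' hyv.le hvi hvj
  have hRL : RAdj p H ∨ LAdj p H := by
    rcases lt_trichotomy p.1 (α + β * v') with hlt | heq | hgt'
    · left
      unfold RAdj
      rw [hpv]
      filter_upwards [havoid (Ioi p.1) (by simp), Ioo_mem_nhdsGT hlt] with u hu hu'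
      refine hgood u ⟨⟨⟨e, he, hev, (hpl hlt e he hev).trans_lt hu'.1⟩, fun hh => ?_⟩,
        ⟨d, hd, hdv, hu'.2.trans hdu⟩, fun hh => ?_⟩ hu
      · have := hpl hlt _ hh rfl; simp only at this; linarith [hu'.1]
      · have := hB _ hh hyv.le; simp only at this; linarith [hu'.2]
    · right
      unfold LAdj
      have hcl : ∀ᶠ u in 𝓝[<] p.1, (u, v') ∉ Z i := by
        have : ContinuousAt (fun u : ℝ => (u, v')) p.1 := by fun_prop
        refine (this.eventually ((h.comp i).isClosed.isOpen_compl.mem_nhds ?_)).filter_mono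
          nhdsWithin_le_nhds
        simp only [heq]; exact hne
      rw [hpv]
      filter_upwards [havoid (Iio p.1) (by simp), Ioo_mem_nhdsLT (heq ▸ heu : e.1 < p.1),
        hcl] with u hu hu' hu2
      refine hgood u ⟨⟨⟨e, he, hev, hu'.1⟩, hu2⟩,
        ⟨d, hd, hdv, by linarith [hu'.2]⟩, fun hh => ?_⟩ hu
      have := hB _ hh hyv.le; simp only at this; linarith [hu'.2]
    · right
      unfold LAdj
      rw [hpv]
      filter_upwards [havoid (Iio p.1) (by simp), Ioo_mem_nhdsLT hgt'] with u hu hu'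
      refine hgood u ⟨⟨⟨e, he, hev, heu.trans hu'.1⟩, fun hh => ?_⟩,
        ⟨d, hd, hdv, hu'.2.trans_le (hpr hgt' d hd hdv)⟩, fun hh => ?_⟩ hu
      · have := hA _ hh hyv.le; simp only at this; linarith [hu'.1]
      · have := hpr hgt' _ hh rfl; simp only at this; linarith [hu'.2]
  obtain ⟨k, rfl | rfl⟩ := hpE
  · exact ⟨k, Or.inl hRL⟩
  · exact ⟨k, Or.inr hRL⟩

end cover

section cover2
variable {m : ℕ} {Z : Fin m → Set (ℝ × ℝ)} {t b : Fin m → ℝ × ℝ} {H H' O : Set (ℝ × ℝ)}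

/-- The nearest hit on the left. -/
lemma Cfg.hit_left (h : Cfg Z t b) {x y : ℝ} (hfr : Fr Z (x, y))
    (hn : ¬ ∀ u ≤ x, Fr Z (u, y)) :
    ∃ a < x, ∃ i, (a, y) ∈ Z i ∧ ∀ u, a < u → u ≤ x → Fr Z (u, y) := by
  have hc : IsCompact (⋃ i, Z i) := isCompact_iUnion h.comp
  have hK : IsCompact ((⋃ i, Z i) ∩ {p : ℝ × ℝ | p.1 ≤ x ∧ p.2 = y}) := by
    refine hc.inter_right (IsClosed.inter (isClosed_le continuous_fst continuous_const)
      (isClosed_eq continuous_snd continuous_const))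
  have hne : ((⋃ i, Z i) ∩ {p : ℝ × ℝ | p.1 ≤ x ∧ p.2 = y}).Nonempty := by
    simp only [Fr] at hn
    push Not at hn
    obtain ⟨u, hu, i, hi⟩ := hn
    exact ⟨(u, y), mem_iUnion.2 ⟨i, hi⟩, hu, rfl⟩
  obtain ⟨⟨a, y'⟩, ⟨hp1, hp2, hp3⟩, hmax⟩ := hK.exists_isMaxOn hne continuous_fst.continuousOn
  simp only at hp2 hp3
  subst hp3
  obtain ⟨i, hi⟩ := mem_iUnion.1 hp1
  refine ⟨a, lt_of_le_of_ne hp2 ?_, i, hi, ?_⟩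
  · rintro rfl; exact hfr i hi
  · intro u hu1 hu2 k hk
    have := hmax (show (u, y') ∈ _ from ⟨mem_iUnion.2 ⟨k, hk⟩, hu2, rfl⟩)
    simp only [mem_ofPred_eq] at this
    linarith

lemma Cfg.hit_right (h : Cfg Z t b) {x y : ℝ} (hfr : Fr Z (x, y))
    (hn : ¬ ∀ u ≥ x, Fr Z (u, y)) :
    ∃ c > x, ∃ i, (c, y) ∈ Z i ∧ ∀ u, x ≤ u → u < c → Fr Z (u, y) := by
  obtain ⟨a, ha, i, hi, hf⟩ := h.flipW.hit_left (x := -x) (y := y)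
    (fun k hk => hfr k (by simpa using hk))
    (fun hh => hn fun u hu k hk => hh (-u) (by linarith) k (by simpa using hk))
  refine ⟨-a, by linarith, i, by simpa using hi, ?_⟩
  intro u h1 h2 k hk
  exact hf (-u) (by linarith) (by linarith) k (by simpa using hk)

lemma Cfg.cover (h : Cfg Z t b) (hO : IsOut Z O) (hH : IsHole Z H) (hne : H ≠ O) :
    ∃ k, (RAdj (t k) H ∨ LAdj (t k) H) ∨ (RAdj (b k) H ∨ LAdj (b k) H) := by
  obtain ⟨⟨x, y0⟩, hz0⟩ := hH.nonempty
  have e1 : ∀ᶠ v in 𝓝[>] y0, (x, v) ∈ H := by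
    have : ContinuousAt (fun v : ℝ => (x, v)) y0 := by fun_prop
    exact (this.eventually ((h.isOpen hH).mem_nhds hz0)).filter_mono nhdsWithin_le_nhds
  have e2 : ∀ q : ℝ, ∀ᶠ v in 𝓝[>] y0, v ≠ q := by
    intro q
    by_cases hq : y0 = q
    · subst hq; filter_upwards [self_mem_nhdsWithin] with u hu; exact (ne_of_gt hu)
    · exact nhdsWithin_le_nhds (isOpen_ne.mem_nhds hq)
  obtain ⟨y, hz, hgt, hgb⟩ := (e1.and ((eventually_all.2 fun k => e2 (t k).2).and
    (eventually_all.2 fun k => e2 (b k).2))).exists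
  have hfr := hH.fr hz
  obtain ⟨a, hax, i, hai, hfa⟩ := h.hit_left hfr fun hh =>
    hne (hH.eq_of_mem hO.1 hz (hO.left hh))
  obtain ⟨c, hxc, j, hcj, hfc⟩ := h.hit_right hfr fun hh =>
    hne (hH.eq_of_mem hO.1 hz (hO.right hh))
  have hfree : ∀ u, a < u → u < c → Fr Z (u, y) := by
    intro u h1 h2
    rcases le_total u x with h3 | h3
    · exact hfa u h1 h3
    · exact hfc u h3 h2
  have hny : ∀ p ∈ Z i, p ∈ Z j → p.2 ≠ y := by
    intro p hpi hpj hpy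
    rcases le_total x p.1 with h3 | h3
    · exact hfr i (row (h.conv i) hai hpi hpy.symm hax.le h3)
    · have := row (h.conv j) hpj hcj hpy h3 (le_of_lt hxc)
      rw [hpy] at this
      exact hfr j this
  by_cases hup : ∀ p ∈ Z i, p ∈ Z j → ¬ y ≤ p.2
  · exact h.cover_up hH hz hax hxc hai hcj hfree hgt hgb hup
  · push Not at hup
    obtain ⟨p, hpi, hpj, hyp⟩ := hup
    have hdn : ∀ q ∈ Z i, q ∈ Z j → ¬ q.2 ≤ y := by
      intro q hqi hqj hqy
      obtain ⟨e, he, hey⟩ := interp ((h.conv i).inter (h.conv j)) ⟨hqi, hqj⟩ ⟨hpi, hpj⟩ hqy hyp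
      exact hny e he.1 he.2 hey
    obtain ⟨k, hk⟩ := h.flipV.cover_up (hH.preimage V) (x := x) (y := -y) (a := a) (c := c)
      (i := i) (j := j) (by simpa using hz) hax hxc (by simpa using hai) (by simpa using hcj)
      (fun u h1 h2 k hk => hfree u h1 h2 k (by simpa using hk))
      (fun k hk => hgb k (by simpa using hk)) (fun k hk => hgt k (by simpa using hk))
      (fun q hq1 hq2 hy => hdn _ hq1 hq2 (by simp; linarith))
    rw [RAdj_V, RAdj_V, LAdj_V, LAdj_V] at hk
    exact ⟨k, hk.symm⟩

lemma Cfg.local_bot (h : Cfg Z t b) (hH : IsHole Z H) (hH' : IsHole Z H') (hne : H ≠ H')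
    {p : ℝ × ℝ} (hR : RAdj p H) (hL : LAdj p H') : ∃ k, b k = p := by
  by_contra hb
  push Not at hb
  apply hne
  -- bodies through p have top p
  have htop : ∀ k, p ∈ Z k → p = t k := by
    intro k hk
    refine h.tuniq k p hk (le_antisymm (h.tmax k p hk) (not_lt.1 fun hlt => ?_))
    have hlt2 : (b k).2 < p.2 := lt_of_le_of_ne (h.bmin k p hk)
      fun he => hb k (h.buniq k p hk he.symm).symm
    obtain ⟨c, hc, d, hd, hcp, hdp, hcd⟩ := h.sec k p.2 hlt2 hlt
    rcases lt_or_ge p.1 d.1 with h1 | h1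
    · obtain ⟨u, hu, hu'⟩ := (hR.and (Ioo_mem_nhdsGT h1)).exists
      exact hH.fr hu k (row (h.conv k) hk hd hdp.symm hu'.1.le hu'.2.le)
    · obtain ⟨u, hu, hu'⟩ := (hL.and (Ioo_mem_nhdsLT (hcd.trans_le h1))).exists
      have := row (h.conv k) hc hk hcp hu'.1.le hu'.2.le
      rw [hcp] at this
      exact hH'.fr hu k this
  have hbox : ∀ᶠ z in 𝓝 p, ∀ k, p ∉ Z k → z ∉ Z k := by
    rw [eventually_all]
    intro k
    by_cases hk : p ∈ Z k
    · simp [hk]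
    · filter_upwards [(h.comp k).isClosed.isOpen_compl.mem_nhds hk] with z hz _ using hz
  obtain ⟨ε, hε, hball⟩ := Metric.eventually_nhds_iff.1 hbox
  have hfr : ∀ u v, |u - p.1| < ε → p.2 < v → v < p.2 + ε → Fr Z (u, v) := by
    intro u v h1 h2 h3 k hk
    refine hball (y := (u, v)) ?_ k ?_ hk
    · rw [Prod.dist_eq, max_lt_iff, Real.dist_eq, Real.dist_eq]
      exact ⟨h1, by rw [abs_lt]; constructor <;> simp only <;> linarith⟩
    · intro hpk
      have h4 := h.tmax k _ hk
      rw [← htop k hpk] at h4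
      simp only at h4; linarith
  obtain ⟨u1, hu1, hu1'⟩ := (hR.and (Ioo_mem_nhdsGT (show p.1 < p.1 + ε by linarith))).exists
  obtain ⟨u2, hu2, hu2'⟩ := (hL.and (Ioo_mem_nhdsLT (show p.1 - ε < p.1 by linarith))).exists
  have hup : ∀ u (G : Set (ℝ × ℝ)), IsHole Z G → (u, p.2) ∈ G → ∀ᶠ v in 𝓝[>] p.2, (u, v) ∈ G := by
    intro u G hG hu
    have : ContinuousAt (fun v : ℝ => (u, v)) p.2 := by fun_prop
    exact (this.eventually ((h.isOpen hG).mem_nhds hu)).filter_mono nhdsWithin_le_nhds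
  obtain ⟨v, g1, g2, g3⟩ := ((hup u1 H hH hu1).and ((hup u2 H' hH' hu2).and
    (Ioo_mem_nhdsGT (show p.2 < p.2 + ε by linarith)))).exists
  have := hH.horiz (u := u1) (u' := u2) (v := v) ?_ g1
  · exact hH.eq_of_mem hH' this g2
  · intro r hr
    rw [uIcc_of_ge (by linarith [hu1'.1, hu2'.2])] at hr
    refine hfr r v ?_ g3.1 g3.2
    rw [abs_lt]; constructor <;> linarith [hr.1, hr.2, hu1'.2, hu2'.1]

lemma Cfg.local_top (h : Cfg Z t b) (hH : IsHole Z H) (hH' : IsHole Z H') (hne : H ≠ H')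
    {p : ℝ × ℝ} (hR : RAdj p H) (hL : LAdj p H') : ∃ k, t k = p := by
  obtain ⟨k, hk⟩ := h.flipV.local_bot (hH.preimage V) (hH'.preimage V)
    (fun he => hne (by rw [← pre_V_V H, he, pre_V_V])) (RAdj_V.2 hR) (LAdj_V.2 hL)
  exact ⟨k, V.injective hk⟩

end cover2

lemma abs_max {ι : Type*} [DecidableEq ι] (f : ι → ℝ) (r : ι → ι → Prop) (hirr : ∀ i, ¬ r i i)
    (htr : ∀ i j k, f j ≤ f i → f j ≤ f k → r i j → r j k → r i k) (S : Finset ι) :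
    S.Nonempty → ∃ C ∈ S, ∀ k ∈ S, ¬ r C k := by
  induction S using Finset.induction_on_min_value f with
  | empty => simp
  | insert a s ha hmin ih =>
    intro _
    rcases s.eq_empty_or_nonempty with rfl | hs
    · exact ⟨a, by simp, by simpa using hirr a⟩
    · obtain ⟨C, hC, hCm⟩ := ih hs
      by_cases hr : r C a
      · refine ⟨a, by simp, fun k hk hak => ?_⟩
        rcases Finset.mem_insert.1 hk with rfl | hk
        · exact hirr _ hak
        · exact hCm k hk (htr C a k (hmin C hC) (hmin k hk) hr hak)
      · refine ⟨C, by simp [hC], fun k hk => ?_⟩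
        rcases Finset.mem_insert.1 hk with rfl | hk
        · exact hr
        · exact hCm k hk

section extremal
variable {m : ℕ} {Z : Fin m → Set (ℝ × ℝ)} {t b : Fin m → ℝ × ℝ} {H H' O : Set (ℝ × ℝ)}

/-- `C` is a rightmost body. -/
def Mx (Z : Fin m → Set (ℝ × ℝ)) (t b : Fin m → ℝ × ℝ) (C : Fin m) : Prop :=
  ∀ k, k ≠ C → ∀ v, (b k).2 < v → v < (t k).2 → (b C).2 < v → v < (t C).2 → Lft (Z k) (Z C)

/-- `D` is a leftmost body. -/
def Mn (Z : Fin m → Set (ℝ × ℝ)) (t b : Fin m → ℝ × ℝ) (D : Fin m) : Prop :=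
  ∀ k, k ≠ D → ∀ v, (b k).2 < v → v < (t k).2 → (b D).2 < v → v < (t D).2 → Lft (Z D) (Z k)

lemma Cfg.exists_extremal (h : Cfg Z t b) (hm : 2 ≤ m) :
    ∃ C D, C ≠ D ∧ Mx Z t b C ∧ Mn Z t b D := by
  classical
  let r : Fin m → Fin m → Prop := fun i k =>
    (∃ v, ((b i).2 < v ∧ v < (t i).2) ∧ (b k).2 < v ∧ v < (t k).2) ∧ Lft (Z i) (Z k)
  have hirr : ∀ i, ¬ r i i := by
    rintro i ⟨⟨v, ⟨h1, h2⟩, _⟩, hl⟩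
    obtain ⟨p, hp, q, hq, hpv, hqv, hpq⟩ := h.sec i v h1 h2
    have := hl q hq p hp (hqv.trans hpv.symm)
    linarith
  have htr : ∀ i j k, (t j).2 ≤ (t i).2 → (t j).2 ≤ (t k).2 → r i j → r j k → r i k := by
    rintro i j k hi hk ⟨⟨v1, ⟨a1, a2⟩, a3, a4⟩, l1⟩ ⟨⟨v2, ⟨c1, c2⟩, c3, c4⟩, l2⟩
    have hv : ∃ v, v1 ≤ v ∧ v2 ≤ v ∧ v < (t j).2 :=
      ⟨max v1 v2, le_max_left _ _, le_max_right _ _, max_lt a4 c2⟩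
    obtain ⟨v, g1, g2, g3⟩ := hv
    refine ⟨⟨v, ⟨by linarith, by linarith⟩, by linarith, by linarith⟩, ?_⟩
    obtain ⟨p, hp, q, hq, hpv, hqv, hpq⟩ := h.sec j v (by linarith) g3
    obtain ⟨p', hp', -, -, hpv', -, -⟩ := h.sec i v (by linarith) (by linarith)
    obtain ⟨q', hq', -, -, hqv', -, -⟩ := h.sec k v (by linarith) (by linarith)
    have e1 := l1 p' hp' p hp (by linarith)
    have e2 := l2 q hq q' hq' (by linarith)
    by_cases hik : i = k
    · subst hik
      have e3 := l1 q' hq' p hp (by linarith)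
      linarith
    · rcases h.lr i k hik with h1 | h1
      · exact h1
      · have := h1 q' hq' p' hp' (by linarith)
        linarith
  have : NeZero m := ⟨by omega⟩
  obtain ⟨D, -, hD⟩ := abs_max (fun i => (t i).2) (fun i k => r k i) hirr
    (fun i j k a1 a2 a3 a4 => htr k j i a2 a1 a4 a3) Finset.univ ⟨0, Finset.mem_univ _⟩
  obtain ⟨C, hC, hC'⟩ := abs_max (fun i => (t i).2) r hirr htr (Finset.univ.erase D) (by
    rw [← Finset.card_pos, Finset.card_erase_of_mem (Finset.mem_univ _)]
    simp; omega)
  refine ⟨C, D, Finset.ne_of_mem_erase hC, ?_, ?_⟩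
  · intro k hk v h1 h2 h3 h4
    rcases h.lr k C hk with hl | hl
    · exact hl
    · exfalso
      have hr : r C k := ⟨⟨v, ⟨h3, h4⟩, h1, h2⟩, hl⟩
      by_cases hkD : k = D
      · subst hkD; exact hD C (Finset.mem_univ _) hr
      · exact hC' k (by simp [hkD]) hr
  · intro k hk v h1 h2 h3 h4
    rcases h.lr k D hk with hl | hl
    · exact absurd ⟨⟨v, ⟨h1, h2⟩, h3, h4⟩, hl⟩ (hD k (Finset.mem_univ _))
    · exact hl

lemma Mx.flipV {C : Fin m} (h : Mx Z t b C) :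
    Mx (fun i => V ⁻¹' Z i) (fun i => V (b i)) (fun i => V (t i)) C := by
  intro k hk v h1 h2 h3 h4 p hp q hq hpq
  simp only [V_apply] at h1 h2 h3 h4
  have := h k hk (-v) (by linarith) (by linarith) (by linarith) (by linarith) _ hp _ hq
    (by simp [hpq])
  simpa using this

lemma Mn.flipV {C : Fin m} (h : Mn Z t b C) :
    Mn (fun i => V ⁻¹' Z i) (fun i => V (b i)) (fun i => V (t i)) C := by
  intro k hk v h1 h2 h3 h4 p hp q hq hpq
  simp only [V_apply] at h1 h2 h3 h4
  have := h k hk (-v) (by linarith) (by linarith) (by linarith) (by linarith) _ hp _ hq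
    (by simp [hpq])
  simpa using this

lemma Mn.flipW {C : Fin m} (h : Mn Z t b C) :
    Mx (fun i => W ⁻¹' Z i) (fun i => W (t i)) (fun i => W (b i)) C := by
  intro k hk v h1 h2 h3 h4 p hp q hq hpq
  simp only [W_apply] at h1 h2 h3 h4
  have := h k hk v (by linarith) (by linarith) (by linarith) (by linarith) _ hq _ hp
    (by simp [hpq])
  simpa using this

lemma Cfg.mx_top (h : Cfg Z t b) (hO : IsOut Z O) {C : Fin m} (hC : Mx Z t b C) :
    RAdj (t C) O := by
  have e2 : ∀ q : ℝ, ∀ᶠ v in 𝓝[>] (t C).1, v ≠ q := by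
    intro q
    by_cases hq : (t C).1 = q
    · subst hq; filter_upwards [self_mem_nhdsWithin] with u hu; exact (ne_of_gt hu)
    · exact nhdsWithin_le_nhds (isOpen_ne.mem_nhds hq)
  unfold RAdj
  filter_upwards [eventually_all.2 fun k => e2 (b k).1, self_mem_nhdsWithin] with u hub hu
  rw [mem_Ioi] at hu
  have hbt := h.bt C
  have hfr : Fr Z (u, (t C).2) := by
    intro k hk
    by_cases hkC : k = C
    · subst hkC
      have := h.tuniq k _ hk rfl
      rw [← this] at hu
      exact lt_irrefl _ hu
    have hlt : (b k).2 < (t C).2 := lt_of_le_of_ne (h.bmin k (u, (t C).2) hk) fun he =>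
      hub k (by rw [← h.buniq k _ hk he.symm])
    have hle : (t C).2 ≤ (t k).2 := h.tmax k (u, (t C).2) hk
    obtain ⟨v, hv1, hv2⟩ := exists_between (max_lt hlt hbt)
    rw [max_lt_iff] at hv1
    have := hC k hkC v hv1.1 (by linarith) hv1.2 hv2 _ hk _ (h.tm C) rfl
    simp only at this; linarith
  obtain ⟨G, hG, hmG⟩ := exists_hole hfr
  have e1 : ∀ᶠ v in 𝓝[<] (t C).2, (u, v) ∈ G := by
    have : ContinuousAt (fun v : ℝ => (u, v)) (t C).2 := by fun_prop
    exact (this.eventually ((h.isOpen hG).mem_nhds hmG)).filter_mono nhdsWithin_le_nhds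
  have e3 : ∀ q : ℝ, ∀ᶠ v in 𝓝[<] (t C).2, v ≠ q := by
    intro q
    by_cases hq : (t C).2 = q
    · subst hq; filter_upwards [self_mem_nhdsWithin] with u hu; exact (ne_of_lt hu)
    · exact nhdsWithin_le_nhds (isOpen_ne.mem_nhds hq)
  have e4 := interp_ev (h.conv C) (h.bm C) (h.tm C) hbt hu
  obtain ⟨v, f1, f2, f3, ⟨e, he, hev, heu⟩, f5⟩ := (e1.and ((eventually_all.2 fun k => e3 (t k).2).and
    ((eventually_all.2 fun k => e3 (b k).2).and (e4.and (Ioo_mem_nhdsLT hbt))))).exists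
  have : (u, v) ∈ O := by
    apply hO.right
    intro w hw k hk
    simp only at hw hk
    have hwC : (w, v) ∉ Z C := by
      intro hwC
      have := row (h.conv C) he hwC hev heu.le hw
      rw [hev] at this
      exact hG.fr f1 C this
    have hkC : k ≠ C := by rintro rfl; exact hwC hk
    have := hC k hkC v (lt_of_le_of_ne (h.bmin k _ hk) (f3 k).symm)
      (lt_of_le_of_ne (h.tmax k _ hk) (f2 k)) f5.1 f5.2 _ hk _ he hev.symm
    simp only at this
    linarith
  rw [hO.1.eq_of_mem hG this f1]
  exact hmG

lemma Cfg.mx_bot (h : Cfg Z t b) (hO : IsOut Z O) {C : Fin m} (hC : Mx Z t b C) :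
    RAdj (b C) O :=
  RAdj_V.1 (h.flipV.mx_top hO.flipV hC.flipV)

lemma Cfg.mn_top (h : Cfg Z t b) (hO : IsOut Z O) {C : Fin m} (hC : Mn Z t b C) :
    LAdj (t C) O :=
  RAdj_W.1 (h.flipW.mx_top hO.flipW hC.flipW)

lemma Cfg.mn_bot (h : Cfg Z t b) (hO : IsOut Z O) {C : Fin m} (hC : Mn Z t b C) :
    LAdj (b C) O :=
  RAdj_W.1 (h.flipW.mx_bot hO.flipW hC.flipW)

end extremal

section fifth
variable {m : ℕ} {Z : Fin m → Set (ℝ × ℝ)} {t b : Fin m → ℝ × ℝ} {H H' O : Set (ℝ × ℝ)}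

lemma Cfg.above_out (h : Cfg Z t b) (hO : IsOut Z O) {C D : Fin m} {y0 : ℝ}
    (hk : ∀ k, k ≠ C → k ≠ D → (t k).2 ≤ y0)
    (hdis : ∀ p ∈ Z C, p ∈ Z D → ¬ y0 ≤ p.2) {u v : ℝ} (hv : y0 < v) (hfr : Fr Z (u, v)) :
    (u, v) ∈ O := by
  by_contra hnO
  obtain ⟨a, hau, i, hai, hfa⟩ := h.hit_left hfr fun hh => hnO (hO.left hh)
  obtain ⟨c, huc, j, hcj, hfc⟩ := h.hit_right hfr fun hh => hnO (hO.right hh)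
  have hin : ∀ k, ∀ p ∈ Z k, v ≤ p.2 → k = C ∨ k = D := by
    intro k p hp hvp
    by_contra hh
    push Not at hh
    have := hk k hh.1 hh.2
    have := h.tmax k p hp
    linarith
  have hij : i ≠ j := by
    rintro rfl
    exact hfr i (row (h.conv i) hai hcj rfl hau.le (le_of_lt huc))
  have hi := hin i _ hai le_rfl
  have hj := hin j _ hcj le_rfl
  have hin' : ∀ k, ∀ p ∈ Z k, v ≤ p.2 → k = i ∨ k = j := by
    intro k p hp hvp
    have := hin k p hp hvp
    rcases hi with rfl | rfl <;> rcases hj with rfl | rfl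
    · exact absurd rfl hij
    · exact this
    · exact this.symm
    · exact absurd rfl hij
  have hd : ∀ p ∈ Z i, p ∈ Z j → ¬ v ≤ p.2 := by
    intro p hpi hpj hvp
    rcases hi with rfl | rfl <;> rcases hj with rfl | rfl
    · exact hij rfl
    · exact hdis p hpi hpj (by linarith)
    · exact hdis p hpj hpi (by linarith)
    · exact hij rfl
  obtain ⟨α, β, hA, hB⟩ := strict_sep (h.comp i) (h.comp j) (h.conv i) (h.conv j) hai hcj
    (hau.trans huc) hd
  obtain ⟨G, hG, hmG⟩ := exists_hole hfr
  have hl1 : a < α + β * v := hA _ hai le_rfl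
  have hl2 : α + β * v < c := hB _ hcj le_rfl
  have h0 : (α + β * v, v) ∈ G := by
    refine hG.horiz (u := u) ?_ hmG
    intro r hr
    rw [mem_uIcc] at hr
    rcases le_total r u with h3 | h3
    · exact hfa r (by rcases hr with hr | hr <;> linarith [hr.1, hr.2]) h3
    · exact hfc r h3 (by rcases hr with hr | hr <;> linarith [hr.1, hr.2])
  have h1 : ∀ w, v ≤ w → (α + β * w, w) ∈ G := by
    intro w hw
    refine hG.path (f := fun r => (α + β * r, r)) (s := v) (by fun_prop) ?_ h0
    intro r hr k hk
    rw [uIcc_of_le hw] at hr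
    rcases hin' k _ hk hr.1 with rfl | rfl
    · exact lt_irrefl _ (hA _ hk hr.1)
    · exact lt_irrefl _ (hB _ hk hr.1)
  obtain ⟨M, hM⟩ := hO.2
  have h2 := h1 (max v |M|) (le_max_left _ _)
  have h3 : (α + β * (max v |M|), max v |M|) ∈ O := by
    apply hM
    rw [Prod.norm_def]
    refine le_max_of_le_right ?_
    rw [Real.norm_eq_abs]
    exact (le_abs_self M).trans ((le_max_right _ _).trans (le_abs_self _))
  exact hnO (hO.1.eq_of_mem hG h3 h2 ▸ hmG)

/-- Every hole adjacent to `p` is the outer hole. -/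
def Neutral (Z : Fin m → Set (ℝ × ℝ)) (O : Set (ℝ × ℝ)) (p : ℝ × ℝ) : Prop :=
  ∀ H, IsHole Z H → (RAdj p H ∨ LAdj p H) → H = O

lemma Cfg.neutral_top (h : Cfg Z t b) (hO : IsOut Z O) {C D : Fin m} {p : ℝ × ℝ}
    (hk : ∀ k, k ≠ C → k ≠ D → (t k).2 ≤ p.2)
    (hdis : ∀ q ∈ Z C, q ∈ Z D → ¬ p.2 ≤ q.2) : Neutral Z O p := by
  intro H hH hadj
  obtain ⟨u, hu⟩ : ∃ u, (u, p.2) ∈ H := by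
    rcases hadj with hh | hh
    · exact hh.exists
    · exact hh.exists
  have e1 : ∀ᶠ v in 𝓝[>] p.2, (u, v) ∈ H := by
    have : ContinuousAt (fun v : ℝ => (u, v)) p.2 := by fun_prop
    exact (this.eventually ((h.isOpen hH).mem_nhds hu)).filter_mono nhdsWithin_le_nhds
  obtain ⟨v, hv, hv'⟩ := (e1.and self_mem_nhdsWithin).exists
  exact hH.eq_of_mem hO.1 hv (h.above_out hO hk hdis hv' (hH.fr hv))

lemma Cfg.neutral_bot (h : Cfg Z t b) (hO : IsOut Z O) {C D : Fin m} {p : ℝ × ℝ}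
    (hk : ∀ k, k ≠ C → k ≠ D → p.2 ≤ (b k).2)
    (hdis : ∀ q ∈ Z C, q ∈ Z D → ¬ q.2 ≤ p.2) : Neutral Z O p := by
  intro H hH hadj
  have := h.flipV.neutral_top hO.flipV (C := C) (D := D) (p := V p)
    (fun k h1 h2 => by simpa using hk k h1 h2)
    (fun q h1 h2 h3 => hdis _ h1 h2 (by simp at h3 ⊢; linarith)) (V ⁻¹' H) (hH.preimage V)
    (by rwa [RAdj_V, LAdj_V])
  rw [← pre_V_V H, this, pre_V_V]

lemma Cfg.fifth (h : Cfg Z t b) (hm : 3 ≤ m) (hO : IsOut Z O) {C D : Fin m} (hCD : C ≠ D)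
    (hC : Mx Z t b C) (hD : Mn Z t b D) :
    ∃ k, k ≠ C ∧ k ≠ D ∧ (Neutral Z O (t k) ∨ Neutral Z O (b k)) := by
  classical
  have hne : ((Finset.univ.erase C).erase D).Nonempty := by
    rw [← Finset.card_pos, Finset.card_erase_of_mem (by simp [hCD.symm]),
      Finset.card_erase_of_mem (Finset.mem_univ _)]
    simp; omega
  obtain ⟨k0, hk0, hmax⟩ := Finset.exists_max_image _ (fun k => (t k).2) hne
  obtain ⟨k1, hk1, hmin⟩ := Finset.exists_min_image _ (fun k => (b k).2) hne
  simp only [Finset.mem_erase, Finset.mem_univ, and_true] at hk0 hk1 hmax hmin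
  by_cases hup : ∀ q ∈ Z C, q ∈ Z D → ¬ (t k0).2 ≤ q.2
  · exact ⟨k0, hk0.2, hk0.1, Or.inl (h.neutral_top hO (fun k h1 h2 => hmax k ⟨h2, h1⟩) hup)⟩
  by_cases hdn : ∀ q ∈ Z C, q ∈ Z D → ¬ q.2 ≤ (b k1).2
  · exact ⟨k1, hk1.2, hk1.1, Or.inr (h.neutral_bot hO (fun k h1 h2 => hmin k ⟨h2, h1⟩) hdn)⟩
  exfalso
  push Not at hup hdn
  obtain ⟨p, hpC, hpD, hp⟩ := hup
  obtain ⟨q, hqC, hqD, hq⟩ := hdn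
  have hb := hmin k0 hk0
  obtain ⟨v, hv1, hv2⟩ := exists_between (h.bt k0)
  obtain ⟨e, ⟨heC, heD⟩, hev⟩ := interp ((h.conv C).inter (h.conv D)) ⟨hqC, hqD⟩ ⟨hpC, hpD⟩
    (show q.2 ≤ v by linarith) (show v ≤ p.2 by linarith)
  have a1 := h.bmin C q hqC
  have a2 := h.bmin D q hqD
  have a3 := h.tmax C p hpC
  have a4 := h.tmax D p hpD
  have l1 := hC k0 hk0.2 v hv1 hv2 (by linarith) (by linarith)
  have l2 := hD k0 hk0.1 v hv1 hv2 (by linarith) (by linarith)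
  obtain ⟨x, hx, y, hy, hxv, hyv, hxy⟩ := h.sec k0 v hv1 hv2
  have := l1 y hy e heC (by linarith)
  have := l2 e heD x hx (by linarith)
  linarith

end fifth

section counting
variable {m : ℕ} {Z : Fin m → Set (ℝ × ℝ)} {t b : Fin m → ℝ × ℝ} {H H' O : Set (ℝ × ℝ)}

lemma RAdj.uniq {p : ℝ × ℝ} (hH : IsHole Z H) (hH' : IsHole Z H') (h1 : RAdj p H)
    (h2 : RAdj p H') : H = H' := by
  obtain ⟨u, h3, h4⟩ := (Filter.Eventually.and h1 h2).exists
  exact hH.eq_of_mem hH' h3 h4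

lemma LAdj.uniq {p : ℝ × ℝ} (hH : IsHole Z H) (hH' : IsHole Z H') (h1 : LAdj p H)
    (h2 : LAdj p H') : H = H' := by
  obtain ⟨u, h3, h4⟩ := (Filter.Eventually.and h1 h2).exists
  exact hH.eq_of_mem hH' h3 h4

open Classical in
/-- A hole satisfying `A`, failing that one satisfying `B`, failing that `O`. -/
noncomputable def sel (A B : Set (ℝ × ℝ) → Prop) (O : Set (ℝ × ℝ)) : Set (ℝ × ℝ) :=
  if h : ∃ H, A H then h.choose else if h : ∃ H, B H then h.choose else O

lemma sel_A {A B : Set (ℝ × ℝ) → Prop} (hA : ∀ H H', A H → A H' → H = H') (h : A H) :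
    sel A B O = H := by
  have hex : ∃ H, A H := ⟨H, h⟩
  unfold sel
  rw [dif_pos hex]
  exact hA _ _ hex.choose_spec h

lemma sel_B {A B : Set (ℝ × ℝ) → Prop} (hB : ∀ H H', B H → B H' → H = H')
    (hn : ¬ ∃ H, A H) (h : B H) : sel A B O = H := by
  have hex : ∃ H, B H := ⟨H, h⟩
  unfold sel
  rw [dif_neg hn, dif_pos hex]
  exact hB _ _ hex.choose_spec h

lemma sel_N {A B : Set (ℝ × ℝ) → Prop} (hA : ∀ H, A H → H = O) (hB : ∀ H, B H → H = O) :
    sel A B O = O := by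
  unfold sel
  split_ifs with h1 h2
  · exact hA _ h1.choose_spec
  · exact hB _ h2.choose_spec
  · rfl

/-- The charging map. -/
noncomputable def phi (Z : Fin m → Set (ℝ × ℝ)) (t b : Fin m → ℝ × ℝ) (O : Set (ℝ × ℝ))
    (e : Fin m × Bool) : Set (ℝ × ℝ) :=
  if e.2 then sel (fun H => IsHole Z H ∧ RAdj (t e.1) H) (fun H => IsHole Z H ∧ LAdj (t e.1) H) O
  else sel (fun H => IsHole Z H ∧ LAdj (b e.1) H) (fun H => IsHole Z H ∧ RAdj (b e.1) H) O

lemma phi_tR {i : Fin m} (hH : IsHole Z H) (h : RAdj (t i) H) : phi Z t b O (i, true) = H := by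
  simp only [phi, if_true]
  exact sel_A (fun H H' h1 h2 => h1.2.uniq h1.1 h2.1 h2.2) ⟨hH, h⟩

lemma phi_bL {i : Fin m} (hH : IsHole Z H) (h : LAdj (b i) H) : phi Z t b O (i, false) = H := by
  simp only [phi, Bool.false_eq_true, if_false]
  exact sel_A (fun H H' h1 h2 => h1.2.uniq h1.1 h2.1 h2.2) ⟨hH, h⟩

lemma phi_tL {i : Fin m} (hH : IsHole Z H) (h : LAdj (t i) H)
    (hn : ¬ ∃ G, IsHole Z G ∧ RAdj (t i) G) : phi Z t b O (i, true) = H := by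
  simp only [phi, if_true]
  exact sel_B (fun H H' h1 h2 => h1.2.uniq h1.1 h2.1 h2.2) hn ⟨hH, h⟩

lemma phi_bR {i : Fin m} (hH : IsHole Z H) (h : RAdj (b i) H)
    (hn : ¬ ∃ G, IsHole Z G ∧ LAdj (b i) G) : phi Z t b O (i, false) = H := by
  simp only [phi, Bool.false_eq_true, if_false]
  exact sel_B (fun H H' h1 h2 => h1.2.uniq h1.1 h2.1 h2.2) hn ⟨hH, h⟩

lemma phi_tN {i : Fin m} (h : Neutral Z O (t i)) : phi Z t b O (i, true) = O := by
  simp only [phi, if_true]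
  exact sel_N (fun H hH => h H hH.1 (Or.inl hH.2)) (fun H hH => h H hH.1 (Or.inr hH.2))

lemma phi_bN {i : Fin m} (h : Neutral Z O (b i)) : phi Z t b O (i, false) = O := by
  simp only [phi, Bool.false_eq_true, if_false]
  exact sel_N (fun H hH => h H hH.1 (Or.inr hH.2)) (fun H hH => h H hH.1 (Or.inl hH.2))

lemma Cfg.phi_surj (h : Cfg Z t b) (hO : IsOut Z O) (hH : IsHole Z H) (hne : H ≠ O) :
    ∃ e, phi Z t b O e = H := by
  obtain ⟨k, (hk | hk) | (hk | hk)⟩ := h.cover hO hH hne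
  · exact ⟨_, phi_tR hH hk⟩
  · by_cases hn : ∃ G, IsHole Z G ∧ RAdj (t k) G
    · obtain ⟨G, hG, hGR⟩ := hn
      by_cases hGH : G = H
      · subst hGH; exact ⟨_, phi_tR hG hGR⟩
      · obtain ⟨k', hk'⟩ := h.local_bot hG hH hGH hGR hk
        exact ⟨(k', false), phi_bL hH (hk' ▸ hk)⟩
    · exact ⟨_, phi_tL hH hk hn⟩
  · by_cases hn : ∃ G, IsHole Z G ∧ LAdj (b k) G
    · obtain ⟨G, hG, hGR⟩ := hn
      by_cases hGH : H = G
      · subst hGH; exact ⟨_, phi_bL hG hGR⟩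
      · obtain ⟨k', hk'⟩ := h.local_top hH hG hGH hk hGR
        exact ⟨(k', true), phi_tR hH (hk' ▸ hk)⟩
    · exact ⟨_, phi_bR hH hk hn⟩
  · exact ⟨_, phi_bL hH hk⟩

lemma Cfg.third (h : Cfg Z t b) (hO : IsOut Z O) {C D : Fin m}
    (hC : Mx Z t b C) (hD : Mn Z t b D) : ∃ e, phi Z t b O e = O ∧
      (e = (C, false) ∨ (e.2 = true ∧ e.1 ≠ C ∧ e.1 ≠ D ∧ ¬ Neutral Z O (t e.1))) := by
  have hCb := h.mx_bot hO hC
  by_cases hn : ∃ G, IsHole Z G ∧ LAdj (b C) G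
  · obtain ⟨G, hG, hGL⟩ := hn
    by_cases hGO : O = G
    · subst hGO; exact ⟨_, phi_bL hG hGL, Or.inl rfl⟩
    · obtain ⟨k, hk⟩ := h.local_top hO.1 hG hGO hCb hGL
      refine ⟨(k, true), phi_tR hO.1 (hk ▸ hCb), Or.inr ⟨rfl, ?_, ?_, ?_⟩⟩
      · rintro rfl
        have := h.bt k
        simp only at hk
        rw [hk] at this
        exact lt_irrefl _ this
      · rintro rfl
        have h1 := h.mn_top hO hD
        simp only at hk h1
        rw [hk] at h1
        exact hGO (h1.uniq hO.1 hG hGL)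
      · intro hN
        exact hGO (hN G hG (Or.inr (by simpa only [hk] using hGL))).symm
  · exact ⟨_, phi_bR hO.1 hCb hn, Or.inl rfl⟩

lemma Cfg.fourth (h : Cfg Z t b) (hO : IsOut Z O) {C D : Fin m}
    (hC : Mx Z t b C) (hD : Mn Z t b D) : ∃ e, phi Z t b O e = O ∧
      (e = (D, true) ∨ (e.2 = false ∧ e.1 ≠ C ∧ e.1 ≠ D ∧ ¬ Neutral Z O (b e.1))) := by
  have hDt := h.mn_top hO hD
  by_cases hn : ∃ G, IsHole Z G ∧ RAdj (t D) G
  · obtain ⟨G, hG, hGL⟩ := hn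
    by_cases hGO : G = O
    · subst hGO; exact ⟨_, phi_tR hG hGL, Or.inl rfl⟩
    · obtain ⟨k, hk⟩ := h.local_bot hG hO.1 hGO hGL hDt
      refine ⟨(k, false), phi_bL hO.1 (hk ▸ hDt), Or.inr ⟨rfl, ?_, ?_, ?_⟩⟩
      · rintro rfl
        have h1 := h.mx_bot hO hC
        simp only at hk h1
        rw [hk] at h1
        exact hGO (hGL.uniq hG hO.1 h1)
      · rintro rfl
        have := h.bt k
        simp only at hk
        rw [hk] at this
        exact lt_irrefl _ this
      · intro hN
        exact hGO (hN G hG (Or.inl (by simpa only [hk] using hGL)))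
  · exact ⟨_, phi_tL hO.1 hDt hn, Or.inl rfl⟩

lemma Cfg.count (h : Cfg Z t b) (hm : 3 ≤ m) :
    {H | IsHole Z H}.Finite ∧ {H | IsHole Z H}.ncard ≤ 2 * m - 4 := by
  classical
  obtain ⟨O, hO⟩ := h.exists_out
  obtain ⟨C, D, hCD, hC, hD⟩ := h.exists_extremal (by omega)
  obtain ⟨k0, hk0C, hk0D, hN⟩ := h.fifth hm hO hCD hC hD
  obtain ⟨e3, p3, d3⟩ := h.third hO hC hD
  obtain ⟨e4, p4, d4⟩ := h.fourth hO hC hD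
  have p1 : phi Z t b O (C, true) = O := phi_tR hO.1 (h.mx_top hO hC)
  have p2 : phi Z t b O (D, false) = O := phi_bL hO.1 (h.mn_bot hO hD)
  obtain ⟨e5, p5, h5C, h5D, hN5⟩ : ∃ e, phi Z t b O e = O ∧ e.1 ≠ C ∧ e.1 ≠ D ∧
      ((e.2 = true ∧ Neutral Z O (t e.1)) ∨ (e.2 = false ∧ Neutral Z O (b e.1))) := by
    rcases hN with hN | hN
    · exact ⟨(k0, true), phi_tN hN, hk0C, hk0D, Or.inl ⟨rfl, hN⟩⟩
    · exact ⟨(k0, false), phi_bN hN, hk0C, hk0D, Or.inr ⟨rfl, hN⟩⟩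
  let F : Finset (Fin m × Bool) := {(C, true), (D, false), e3, e4, e5}
  have n12 : ((C, true) : Fin m × Bool) ≠ (D, false) := by simp
  have n13 : (C, true) ≠ e3 := by
    rintro rfl; rcases d3 with d3 | d3
    · simp at d3
    · exact d3.2.1 rfl
  have n14 : (C, true) ≠ e4 := by
    rintro rfl; rcases d4 with d4 | d4
    · simp at d4; exact hCD d4
    · exact d4.2.1 rfl
  have n15 : (C, true) ≠ e5 := by rintro rfl; exact h5C rfl
  have n23 : (D, false) ≠ e3 := by
    rintro rfl; rcases d3 with d3 | d3
    · simp at d3; exact hCD d3.symm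
    · exact d3.2.2.1 rfl
  have n24 : (D, false) ≠ e4 := by
    rintro rfl; rcases d4 with d4 | d4
    · simp at d4
    · exact d4.2.2.1 rfl
  have n25 : (D, false) ≠ e5 := by rintro rfl; exact h5D rfl
  have n34 : e3 ≠ e4 := by
    rintro rfl
    rcases d3 with d3 | d3 <;> rcases d4 with d4 | d4
    · rw [d3] at d4; simp at d4
    · rw [d3] at d4; exact d4.2.1 rfl
    · rw [d4] at d3; exact d3.2.2.1 rfl
    · rw [d3.1] at d4; simp at d4
  have n35 : e3 ≠ e5 := by
    rintro rfl
    rcases d3 with d3 | d3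
    · rw [d3] at h5C; exact h5C rfl
    · rcases hN5 with hN5 | hN5
      · exact d3.2.2.2 hN5.2
      · rw [d3.1] at hN5; simp at hN5
  have n45 : e4 ≠ e5 := by
    rintro rfl
    rcases d4 with d4 | d4
    · rw [d4] at h5D; exact h5D rfl
    · rcases hN5 with hN5 | hN5
      · rw [d4.1] at hN5; simp at hN5
      · exact d4.2.2.2 hN5.2
  have hF : F.card = 5 := by
    simp only [F]
    rw [Finset.card_insert_of_notMem, Finset.card_insert_of_notMem, Finset.card_insert_of_notMem,
      Finset.card_insert_of_notMem, Finset.card_singleton]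
    · simpa using n45
    · simpa using ⟨n34, n35⟩
    · simp only [Finset.mem_insert, Finset.mem_singleton, not_or]
      exact ⟨n23, n24, n25⟩
    · simp only [Finset.mem_insert, Finset.mem_singleton, not_or]
      exact ⟨n12, n13, n14, n15⟩
  have hFO : ∀ e ∈ F, phi Z t b O e = O := by
    intro e he
    simp only [F, Finset.mem_insert, Finset.mem_singleton] at he
    rcases he with rfl | rfl | rfl | rfl | rfl <;> assumption
  have hsub : {H | IsHole Z H} ⊆ ((insert O ((Finset.univ \ F).image (phi Z t b O)) :
      Finset (Set (ℝ × ℝ))) : Set (Set (ℝ × ℝ))) := by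
    intro H hH
    rw [Finset.mem_coe, Finset.mem_insert]
    by_cases hne : H = O
    · exact Or.inl hne
    · right
      obtain ⟨e, he⟩ := h.phi_surj hO hH hne
      refine Finset.mem_image.2 ⟨e, ?_, he⟩
      rw [Finset.mem_sdiff]
      exact ⟨Finset.mem_univ _, fun heF => hne (he ▸ hFO e heF)⟩
  refine ⟨(Finset.finite_toSet _).subset hsub, ?_⟩
  refine (ncard_le_ncard hsub (Finset.finite_toSet _)).trans ?_
  rw [ncard_coe_finset]
  refine (Finset.card_insert_le _ _).trans ?_
  have h1 : ((Finset.univ \ F).image (phi Z t b O)).card ≤ (Finset.univ \ F).card :=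
    Finset.card_image_le
  rw [Finset.card_sdiff_of_subset (Finset.subset_univ _), hF] at h1
  simp at h1
  omega

end counting

section reduction
variable {m : ℕ} {Z : Fin m → Set (ℝ × ℝ)}

lemma sec_aux {A : Set (ℝ × ℝ)} (hA : Convex ℝ A) {p q e : ℝ × ℝ} (hp : p ∈ A) (hq : q ∈ A)
    (he : e ∈ A) (hpq2 : p.2 = q.2) (hpq : p.1 < q.1) {l v : ℝ} (hl0 : 0 ≤ l) (hl1 : l < 1)
    (hv : v = (1 - l) * p.2 + l * e.2) :
    ∃ p' ∈ A, ∃ q' ∈ A, p'.2 = v ∧ q'.2 = v ∧ p'.1 < q'.1 := by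
  refine ⟨_, hA hp he (a := 1 - l) (b := l) (by linarith) hl0 (by ring), _,
    hA hq he (a := 1 - l) (b := l) (by linarith) hl0 (by ring), ?_, ?_, ?_⟩
  · simp [hv]
  · simp [hv, hpq2]
  · simp only [Prod.fst_add, Prod.smul_fst, smul_eq_mul]
    nlinarith

lemma exists_cfg (hZ : ∀ i, IsConvexBody (Z i))
    (hdisj : ∀ i j, i ≠ j → Disjoint (interior (Z i)) (interior (Z j)))
    (hu : ∀ i, ∀ p ∈ Z i, ∀ q ∈ Z i, p.1 < q.1 → (∀ z ∈ Z i, z.2 ≤ p.2) → ¬ ∀ z ∈ Z i, z.2 ≤ q.2)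
    (hl : ∀ i, ∀ p ∈ Z i, ∀ q ∈ Z i, p.1 < q.1 → (∀ z ∈ Z i, p.2 ≤ z.2) → ¬ ∀ z ∈ Z i, q.2 ≤ z.2) :
    ∃ t b, Cfg Z t b := by
  have hne : ∀ i, (Z i).Nonempty := fun i => (hZ i).2.2.mono interior_subset
  have ht : ∀ i, ∃ t ∈ Z i, ∀ z ∈ Z i, z.2 ≤ t.2 := fun i =>
    (hZ i).1.exists_isMaxOn (hne i) continuous_snd.continuousOn
  have hb : ∀ i, ∃ b ∈ Z i, ∀ z ∈ Z i, b.2 ≤ z.2 := fun i =>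
    (hZ i).1.exists_isMinOn (hne i) continuous_snd.continuousOn
  choose t tm tmax using ht
  choose b bm bmin using hb
  have tuniq : ∀ i, ∀ p ∈ Z i, p.2 = (t i).2 → p = t i := by
    intro i p hp hpe
    refine Prod.ext ?_ hpe
    rcases lt_trichotomy p.1 (t i).1 with h | h | h
    · exact absurd (tmax i) (hu i p hp _ (tm i) h (by rw [hpe]; exact tmax i))
    · exact h
    · exact absurd (by rw [hpe]; exact tmax i) (hu i _ (tm i) p hp h (tmax i))
  have buniq : ∀ i, ∀ p ∈ Z i, p.2 = (b i).2 → p = b i := by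
    intro i p hp hpe
    refine Prod.ext ?_ hpe
    rcases lt_trichotomy p.1 (b i).1 with h | h | h
    · exact absurd (bmin i) (hl i p hp _ (bm i) h (by rw [hpe]; exact bmin i))
    · exact h
    · exact absurd (by rw [hpe]; exact bmin i) (hl i _ (bm i) p hp h (bmin i))
  have hball : ∀ i, ∃ x : ℝ × ℝ, ∃ ε > 0, ∀ u v, |u - x.1| < ε → |v - x.2| < ε → (u, v) ∈ Z i := by
    intro i
    obtain ⟨x, hx⟩ := (hZ i).2.2
    obtain ⟨ε, hε, hs⟩ := Metric.mem_nhds_iff.1 (mem_interior_iff_mem_nhds.1 hx)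
    refine ⟨x, ε, hε, fun u v h1 h2 => hs ?_⟩
    rw [Metric.mem_ball, Prod.dist_eq, max_lt_iff, Real.dist_eq, Real.dist_eq]
    exact ⟨h1, h2⟩
  have hlev : ∀ i, ∃ p ∈ Z i, ∃ q ∈ Z i, p.2 = q.2 ∧ p.1 < q.1 ∧ (b i).2 < p.2 ∧ p.2 < (t i).2 := by
    intro i
    obtain ⟨x, ε, hε, hs⟩ := hball i
    have a1 : |ε / 2| < ε := by rw [abs_of_pos (by linarith)]; linarith
    have a2 : |-(ε / 2)| < ε := by rwa [abs_neg]
    have h1 := tmax i _ (hs x.1 (x.2 + ε / 2) (by simpa using hε) (by simpa using a1))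
    have h2 := bmin i _ (hs x.1 (x.2 - ε / 2) (by simpa using hε) (by simpa using a1))
    simp only at h1 h2
    refine ⟨(x.1 - ε / 2, x.2), hs _ _ (by simpa using a1) (by simpa using hε),
      (x.1 + ε / 2, x.2), hs _ _ (by simpa using a1) (by simpa using hε), rfl, ?_, ?_, ?_⟩
    · simp only; linarith
    · simp only; linarith
    · simp only; linarith
  refine ⟨t, b, fun i => (hZ i).1, fun i => (hZ i).2.1, tm, bm, tmax, bmin, tuniq, buniq, ?_, ?_, ?_⟩
  · intro i
    obtain ⟨p, -, q, -, -, -, h1, h2⟩ := hlev i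
    linarith
  · intro i v hv1 hv2
    obtain ⟨p, hp, q, hq, hpq2, hpq, h1, h2⟩ := hlev i
    rcases le_total p.2 v with hv | hv
    · have hpos : 0 < (t i).2 - p.2 := by linarith
      refine sec_aux (hZ i).2.1 hp hq (tm i) hpq2 hpq (l := (v - p.2) / ((t i).2 - p.2))
        (div_nonneg (by linarith) hpos.le) ((div_lt_one hpos).2 (by linarith)) ?_
      field_simp; ring
    · have hpos : 0 < p.2 - (b i).2 := by linarith
      refine sec_aux (hZ i).2.1 hp hq (bm i) hpq2 hpq (l := (p.2 - v) / (p.2 - (b i).2))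
        (div_nonneg (by linarith) hpos.le) ((div_lt_one hpos).2 (by linarith)) ?_
      field_simp; ring
  · intro i k hik
    obtain ⟨f, u, hfu, huf⟩ := geometric_hahn_banach_open_open (hZ i).2.1.interior isOpen_interior
      (hZ k).2.1.interior isOpen_interior (hdisj i k hik)
    obtain ⟨α, β, hf⟩ : ∃ α β : ℝ, ∀ p : ℝ × ℝ, f p = p.1 * α + p.2 * β := by
      refine ⟨f (1, 0), f (0, 1), fun p => ?_⟩
      have : p = p.1 • ((1 : ℝ), (0 : ℝ)) + p.2 • ((0 : ℝ), (1 : ℝ)) := by ext <;> simp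
      conv_lhs => rw [this]
      rw [map_add, map_smul, map_smul, smul_eq_mul, smul_eq_mul]
    have hcl : ∀ j, Z j ⊆ closure (interior (Z j)) := fun j => by
      rw [(hZ j).2.1.closure_interior_eq_closure_of_nonempty_interior (hZ j).2.2]
      exact subset_closure
    have h1 : ∀ p ∈ Z i, f p ≤ u := fun p hp =>
      closure_minimal (t := {p | f p ≤ u}) (fun q hq => (hfu q hq).le)
        (isClosed_le f.continuous continuous_const) (hcl i hp)
    have h2 : ∀ p ∈ Z k, u ≤ f p := fun p hp =>
      closure_minimal (t := {p | u ≤ f p}) (fun q hq => (huf q hq).le)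
        (isClosed_le continuous_const f.continuous) (hcl k hp)
    obtain ⟨x, hx⟩ := (hZ i).2.2
    obtain ⟨y, hy⟩ := (hZ k).2.2
    have hxy := (hfu x hx).trans (huf y hy)
    simp only [hf] at h1 h2 hxy
    clear hfu huf hf
    rcases lt_trichotomy α 0 with hα | hα | hα
    · right
      intro p hp q hq hpq
      have a1 := h1 q hq
      have a2 := h2 p hp
      rw [hpq] at a2
      nlinarith
    · subst hα
      simp only [mul_zero, zero_add] at h1 h2 hxy
      have key : ∃ c d : ℝ × ℝ, ∀ p ∈ Z i, ∀ q ∈ Z k, p.2 = q.2 → p = c ∧ q = d := by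
        rcases lt_trichotomy β 0 with hβ | hβ | hβ
        · refine ⟨b i, t k, fun p hp q hq hpq => ⟨?_, ?_⟩⟩
          · apply buniq i p hp
            have a1 := h1 _ (bm i)
            have a2 := h2 q hq
            have a3 := bmin i p hp
            rw [← hpq] at a2
            nlinarith
          · apply tuniq k q hq
            have a1 := h1 p hp
            have a2 := h2 _ (tm k)
            have a3 := tmax k q hq
            rw [hpq] at a1
            nlinarith
        · subst hβ; simp at hxy
        · refine ⟨t i, b k, fun p hp q hq hpq => ⟨?_, ?_⟩⟩
          · apply tuniq i p hp
            have a1 := h1 _ (tm i)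
            have a2 := h2 q hq
            have a3 := tmax i p hp
            rw [← hpq] at a2
            nlinarith
          · apply buniq k q hq
            have a1 := h1 p hp
            have a2 := h2 _ (bm k)
            have a3 := bmin k q hq
            rw [hpq] at a1
            nlinarith
      obtain ⟨c, d, hcd⟩ := key
      rcases le_total c.1 d.1 with h3 | h3
      · left
        intro p hp q hq hpq
        obtain ⟨rfl, rfl⟩ := hcd p hp q hq hpq
        exact h3
      · right
        intro q hq p hp hpq
        obtain ⟨rfl, rfl⟩ := hcd p hp q hq hpq.symm
        exact h3
    · left
      intro p hp q hq hpq
      have a1 := h1 p hp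
      have a2 := h2 q hq
      rw [hpq] at a1
      nlinarith

/-- Slopes for which the extreme level is attained at two points. -/
def Bad (A : Set (ℝ × ℝ)) (ε : ℝ) : Set ℝ :=
  {s | ∃ p ∈ A, ∃ q ∈ A, p.1 < q.1 ∧ (∀ z ∈ A, ε * (z.2 - s * z.1) ≤ ε * (p.2 - s * p.1)) ∧
    ∀ z ∈ A, ε * (z.2 - s * z.1) ≤ ε * (q.2 - s * q.1)}

lemma bad_countable (A : Set (ℝ × ℝ)) (ε : ℝ) (hε : ε ≠ 0) : (Bad A ε).Countable := by
  have hex : ∀ s : ℝ, ∃ p q : ℝ × ℝ, s ∈ Bad A ε → p ∈ A ∧ q ∈ A ∧ p.1 < q.1 ∧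
      (∀ z ∈ A, ε * (z.2 - s * z.1) ≤ ε * (p.2 - s * p.1)) ∧
      ∀ z ∈ A, ε * (z.2 - s * z.1) ≤ ε * (q.2 - s * q.1) := by
    intro s
    by_cases hs : s ∈ Bad A ε
    · obtain ⟨p, hp, q, hq, h⟩ := hs
      exact ⟨p, q, fun _ => ⟨hp, hq, h⟩⟩
    · exact ⟨0, 0, fun h => absurd h hs⟩
  choose p q hpq using hex
  have hd : (Bad A ε).PairwiseDisjoint (fun s => Ioo (p s).1 (q s).1) := by
    intro s hs s' hs' hne
    obtain ⟨a1, a2, a3, a4, a5⟩ := hpq s hs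
    obtain ⟨b1, b2, b3, b4, b5⟩ := hpq s' hs'
    have c1 := a4 _ b2
    have c2 := b5 _ a1
    have c3 := a5 _ b1
    have c4 := b4 _ a2
    have d1 : 0 ≤ ε * (s' - s) * ((p s).1 - (q s').1) := by nlinarith
    have d2 : 0 ≤ ε * (s' - s) * ((q s).1 - (p s').1) := by nlinarith
    have hnz : ε * (s' - s) ≠ 0 := mul_ne_zero hε (sub_ne_zero.2 hne.symm)
    rw [Function.onFun, Set.disjoint_left]
    rintro x ⟨x1, x2⟩ ⟨x3, x4⟩
    rcases lt_or_gt_of_ne hnz with h | h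
    · nlinarith
    · nlinarith
  exact hd.countable_of_isOpen (fun s _ => isOpen_Ioo) fun s hs => nonempty_Ioo.2 (hpq s hs).2.2.1

/-- The shear. -/
def shear (s : ℝ) : ℝ × ℝ ≃ₜ ℝ × ℝ where
  toFun z := (z.1, z.2 + s * z.1)
  invFun z := (z.1, z.2 - s * z.1)
  left_inv z := by simp
  right_inv z := by simp
  continuous_toFun := by fun_prop
  continuous_invFun := by fun_prop

@[simp] lemma shear_apply (s : ℝ) (z : ℝ × ℝ) : shear s z = (z.1, z.2 + s * z.1) := rfl
@[simp] lemma shear_symm_apply (s : ℝ) (z : ℝ × ℝ) :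
    (shear s).symm z = (z.1, z.2 - s * z.1) := rfl

lemma shear_lin (s : ℝ) : IsLinearMap ℝ (shear s) :=
  ⟨fun x y => by ext <;> simp; ring, fun c x => by ext <;> simp; ring⟩

lemma main (hm : 3 ≤ m) (hZ : ∀ i, IsConvexBody (Z i))
    (hdisj : ∀ i j, i ≠ j → Disjoint (interior (Z i)) (interior (Z j))) :
    {H | IsHole Z H}.Finite ∧ {H | IsHole Z H}.ncard ≤ 2 * m - 4 := by
  have hcount : (⋃ i, (Bad (Z i) 1 ∪ Bad (Z i) (-1))).Countable :=
    countable_iUnion fun i => (bad_countable _ _ (by norm_num)).union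
      (bad_countable _ _ (by norm_num))
  obtain ⟨s, hs⟩ : ∃ s, s ∉ ⋃ i, (Bad (Z i) 1 ∪ Bad (Z i) (-1)) := by
    by_contra hh
    push Not at hh
    exact Cardinal.not_countable_real (hcount.mono fun x _ => hh x)
  simp only [mem_iUnion, mem_union, not_exists, not_or] at hs
  have hpull : ∀ i, ∀ z ∈ Z i, (shear s).symm z ∈ shear s ⁻¹' Z i := by
    intro i z hz
    rw [mem_preimage, Homeomorph.apply_symm_apply]; exact hz
  obtain ⟨t, b, h⟩ := exists_cfg (Z := fun i => shear s ⁻¹' Z i)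
    (fun i => ⟨(shear s).isCompact_preimage.2 (hZ i).1,
      (hZ i).2.1.is_linear_preimage (shear_lin s), by
        rw [← (shear s).preimage_interior]
        exact (hZ i).2.2.preimage (shear s).surjective⟩)
    (fun i j hij => by
      simp only [← (shear s).preimage_interior]
      exact (hdisj i j hij).preimage _)
    (by
      intro i p hp q hq hpq h1 h2
      refine (hs i).1 ⟨_, hp, _, hq, hpq, fun z hz => ?_, fun z hz => ?_⟩
      · have := h1 _ (hpull i z hz); simp at this ⊢; linarith
      · have := h2 _ (hpull i z hz); simp at this ⊢; linarith)
    (by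
      intro i p hp q hq hpq h1 h2
      refine (hs i).2 ⟨_, hp, _, hq, hpq, fun z hz => ?_, fun z hz => ?_⟩
      · have := h1 _ (hpull i z hz); simp at this ⊢; linarith
      · have := h2 _ (hpull i z hz); simp at this ⊢; linarith)
  obtain ⟨hfin, hcard⟩ := h.count hm
  have hmaps : MapsTo (fun H => shear s ⁻¹' H) {H | IsHole Z H}
      {H | IsHole (fun i => shear s ⁻¹' Z i) H} := fun H hH => hH.preimage _
  have hinj : InjOn (fun H => shear s ⁻¹' H) {H | IsHole Z H} :=
    (preimage_injective.2 (shear s).surjective).injOn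
  exact ⟨hfin.of_injOn hmaps hinj, (ncard_le_ncard_of_injOn _ hmaps hinj hfin).trans hcard⟩

end reduction

end CH

theorem convex_holes_upper_bound (m : ℕ) (hm : 3 ≤ m) (Z : Fin m → Set (ℝ × ℝ))
    (hZ : ∀ i, IsConvexBody (Z i))
    (hdisj : ∀ i j, i ≠ j → Disjoint (interior (Z i)) (interior (Z j))) :
    ({H : Set (ℝ × ℝ) | ∃ x ∈ (⋃ i, Z i)ᶜ,
        H = connectedComponentIn (⋃ i, Z i)ᶜ x}).Finite ∧
    ({H : Set (ℝ × ℝ) | ∃ x ∈ (⋃ i, Z i)ᶜ,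
        H = connectedComponentIn (⋃ i, Z i)ᶜ x}).ncard ≤ 2 * m - 4 := by
  exact CH.main hm hZ hdisj
end
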